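/- arXiv:2605.07923 — 7 statements merged into one kernel-verified Lean document; each statement's English description precedes it below -/
import Mathlib

section
/- Let n be a type sequence with n = Σ_i n_i vertices and let m be a type sequence with m_i ≤ n_i for all i and m := Σ_i m_i > n/2. Then |𝒞_n^m| = (∏_{i≥1} C(n_i, m_i)) · |𝒞c_m| · |𝒞_{n−m}|, and |𝒮_n^m| = (∏_{i≥1} C(n_i, m_i)) · |𝒮c_m| · |𝒮_{n−m}|. -/
namespace PaperCM

noncomputable section

/-- Number of vertices of a type sequence. -/
def numV (m : ℕ →₀ ℕ) : ℕ := m.sum fun _ c => c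

/-- Total degree of a type sequence. -/
def totalDeg (m : ℕ →₀ ℕ) : ℕ := m.sum fun i c => i * c

/-- The nondecreasing degree sequence associated with a type sequence:
`degOf m i` is the least `j` with `m 1 + ⋯ + m j ≥ i + 1` (vertices `0`-indexed). -/
def degOf (m : ℕ →₀ ℕ) (i : ℕ) : ℕ :=
  sInf {j : ℕ | i < ∑ k ∈ Finset.Icc 1 j, m k}

/-- The half-edges of a type sequence: pairs `(v, j)` with `j < d_v`. -/
abbrev HalfEdges (m : ℕ →₀ ℕ) := Σ v : Fin (numV m), Fin (degOf m (v : ℕ))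

/-- A configuration: a perfect matching of the half-edges, encoded as a
fixed-point free involution. -/
def IsConfig (m : ℕ →₀ ℕ) (f : HalfEdges m → HalfEdges m) : Prop :=
  Function.Involutive f ∧ ∀ x, f x ≠ x

/-- Adjacency in the multigraph induced by a configuration. -/
def adj (m : ℕ →₀ ℕ) (f : HalfEdges m → HalfEdges m) (u v : Fin (numV m)) : Prop :=
  ∃ (j : Fin (degOf m (u : ℕ))) (j' : Fin (degOf m (v : ℕ))), f ⟨u, j⟩ = ⟨v, j'⟩

/-- The multigraph of the configuration is connected. -/
def IsConn (m : ℕ →₀ ℕ) (f : HalfEdges m → HalfEdges m) : Prop :=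
  ∀ u v : Fin (numV m), Relation.ReflTransGen (adj m f) u v

/-- The configuration is simple: no self-loops and no multiple edges. -/
def IsSimple (m : ℕ →₀ ℕ) (f : HalfEdges m → HalfEdges m) : Prop :=
  (∀ x : HalfEdges m, (f x).1 ≠ x.1) ∧
    ∀ x y : HalfEdges m, x.1 = y.1 → (f x).1 = (f y).1 → x = y ∨ x = f y

/-- The vertex set of the component of `v`. -/
def component (m : ℕ →₀ ℕ) (f : HalfEdges m → HalfEdges m) (v : Fin (numV m)) :
    Set (Fin (numV m)) :=
  {u | Relation.ReflTransGen (adj m f) v u}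

/-- The type of the component of `v`: the number of its vertices of each degree. -/
def compType (m : ℕ →₀ ℕ) (f : HalfEdges m → HalfEdges m) (v : Fin (numV m)) (i : ℕ) : ℕ :=
  Set.ncard {u : Fin (numV m) | u ∈ component m f v ∧ degOf m (u : ℕ) = i}

/-- The configuration has a component with type `m'`. -/
def HasCompOfType (m : ℕ →₀ ℕ) (f : HalfEdges m → HalfEdges m) (m' : ℕ →₀ ℕ) : Prop :=
  ∃ v : Fin (numV m), ∀ i, compType m f v i = m' i

/-- `v` is the minimal representative of its component. -/
def IsRep (m : ℕ →₀ ℕ) (f : HalfEdges m → HalfEdges m) (v : Fin (numV m)) : Prop :=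
  ∀ u ∈ component m f v, v ≤ u

/-- Number of components of the configuration whose type lies in `𝒩`. -/
def numCompIn (m : ℕ →₀ ℕ) (f : HalfEdges m → HalfEdges m) (𝒩 : Set (ℕ →₀ ℕ)) : ℕ :=
  Set.ncard {v : Fin (numV m) | IsRep m f v ∧ ∃ m' ∈ 𝒩, ∀ i, compType m f v i = m' i}

/-- `|𝒞_m|`: the number of configurations with type `m`. -/
def cC (m : ℕ →₀ ℕ) : ℕ := Set.ncard {f | IsConfig m f}
/-- `|𝒞c_m|`: the number of connected configurations with type `m`. -/
def cCc (m : ℕ →₀ ℕ) : ℕ := Set.ncard {f | IsConfig m f ∧ IsConn m f}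
/-- `|𝒮_m|`: the number of simple configurations with type `m`. -/
def cS (m : ℕ →₀ ℕ) : ℕ := Set.ncard {f | IsConfig m f ∧ IsSimple m f}
/-- `|𝒮c_m|`: the number of connected simple configurations with type `m`. -/
def cSc (m : ℕ →₀ ℕ) : ℕ := Set.ncard {f | IsConfig m f ∧ IsSimple m f ∧ IsConn m f}
/-- `|𝒞_m^{m'}|`: configurations with type `m` having a component of type `m'`. -/
def cCcomp (m m' : ℕ →₀ ℕ) : ℕ := Set.ncard {f | IsConfig m f ∧ HasCompOfType m f m'}
/-- `|𝒮_m^{m'}|`. -/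
def cScomp (m m' : ℕ →₀ ℕ) : ℕ :=
  Set.ncard {f | IsConfig m f ∧ IsSimple m f ∧ HasCompOfType m f m'}
/-- `|𝒞_m^{𝒩}|`: configurations with type `m` having a component whose type lies in `𝒩`. -/
def cCcompSet (m : ℕ →₀ ℕ) (𝒩 : Set (ℕ →₀ ℕ)) : ℕ :=
  Set.ncard {f | IsConfig m f ∧ ∃ m' ∈ 𝒩, HasCompOfType m f m'}
/-- `|𝒮_m^{𝒩}|`. -/
def cScompSet (m : ℕ →₀ ℕ) (𝒩 : Set (ℕ →₀ ℕ)) : ℕ :=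
  Set.ncard {f | IsConfig m f ∧ IsSimple m f ∧ ∃ m' ∈ 𝒩, HasCompOfType m f m'}

/-- The type sequence `n(n) = (n_i(n))_{i ≥ 1}` of the degree sequence `d(n)`. -/
def typeOf (d : (n : ℕ) → Fin n → ℕ) (n : ℕ) : ℕ →₀ ℕ :=
  ∑ j : Fin n, Finsupp.single (d n j) 1

/-- The total degree `ℓ_n = Σ_i i·n_i = Σ_j d_j(n)`. -/
def ℓTot (d : (n : ℕ) → Fin n → ℕ) (n : ℕ) : ℕ := ∑ j : Fin n, d n j

/-- The set `𝒩^ε(n)` of type sequences approximating `n` from below. -/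
def Neps (ε : ℝ) (nn : ℕ →₀ ℕ) : Set (ℕ →₀ ℕ) :=
  {m | m ≤ nn ∧ (1 - ε) * (totalDeg nn : ℝ) < (totalDeg m : ℝ)}

/-- `β(p)`: the solution in `(0,1)` of the fixed-point equation
`Σ_k k p_k = (1-β²) Σ_k k p_k/(1-β^k)`. -/
def betaOf (p : ℕ → ℝ) : ℝ :=
  sInf {β : ℝ | β ∈ Set.Ioo 0 1 ∧
    ∑' k : ℕ, (k : ℝ) * p k = (1 - β ^ 2) * ∑' k : ℕ, (k : ℝ) * p k / (1 - β ^ k)}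

/-- The exponential rate `K(p)`. -/
def Kof (p : ℕ → ℝ) : ℝ :=
  (∑' k : ℕ, (k : ℝ) * p k) / 2 * Real.log (1 - betaOf p ^ 2)
    - ∑' k : ℕ, p k * Real.log (1 - betaOf p ^ k)

end

end PaperCM

namespace PaperCM

section Matchings

variable {V H V' H' : Type*}

/-- A perfect matching `f` of the half-edges `H`, attached to vertices by `π`; when `b` holds, the
induced multigraph is moreover required to be simple. -/
def IsMatching (b : Prop) (π : H → V) (f : H → H) : Prop :=
  (Function.Involutive f ∧ ∀ x, f x ≠ x) ∧
    (b → (∀ x, π (f x) ≠ π x) ∧ ∀ x y, π x = π y → π (f x) = π (f y) → x = y ∨ x = f y)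

/-- Adjacency in the multigraph induced by a matching. -/
def MAdj (π : H → V) (f : H → H) (u v : V) : Prop := ∃ x, π x = u ∧ π (f x) = v

/-- Connectedness of the multigraph induced by a matching. -/
def MConn (π : H → V) (f : H → H) : Prop := ∀ u v, Relation.ReflTransGen (MAdj π f) u v

/-- The vertex set `S` is a component of the multigraph induced by a matching. -/
def IsComp (π : H → V) (f : H → H) (S : Set V) : Prop :=
  ∃ v, ∀ u, u ∈ S ↔ Relation.ReflTransGen (MAdj π f) v u

/-- The attachment map of the half-edges at the vertices of `S`. -/
def restr (π : H → V) (S : Set V) (x : {x // π x ∈ S}) : S := ⟨π x, x.2⟩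

theorem MAdj.symm {π : H → V} {f : H → H} (hf : Function.Involutive f) {u v : V}
    (h : MAdj π f u v) : MAdj π f v u := by
  obtain ⟨x, rfl, rfl⟩ := h
  exact ⟨f x, rfl, by rw [hf x]⟩

theorem reachable_symm {π : H → V} {f : H → H} (hf : Function.Involutive f) {u v : V}
    (h : Relation.ReflTransGen (MAdj π f) u v) : Relation.ReflTransGen (MAdj π f) v u :=
  have : Std.Symm (MAdj π f) := ⟨fun _ _ => MAdj.symm hf⟩
  symm h

theorem IsComp.eq_of_mem {π : H → V} {f : H → H} (hf : Function.Involutive f) {S T : Set V}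
    (hS : IsComp π f S) (hT : IsComp π f T) {w : V} (hwS : w ∈ S) (hwT : w ∈ T) : S = T := by
  obtain ⟨a, ha⟩ := hS
  obtain ⟨c, hc⟩ := hT
  have h1 := (ha w).1 hwS
  have h2 := (hc w).1 hwT
  ext u
  rw [ha, hc]
  exact ⟨fun h => h2.trans ((reachable_symm hf h1).trans h),
    fun h => h1.trans ((reachable_symm hf h2).trans h)⟩

theorem IsComp.map_mem {π : H → V} {f : H → H} {S : Set V}
    (hS : IsComp π f S) {x : H} (hx : π x ∈ S) : π (f x) ∈ S := by
  obtain ⟨a, ha⟩ := hS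
  rw [ha] at hx ⊢
  exact hx.tail ⟨x, rfl, rfl⟩

open Classical in
/-- The matching obtained from one on the half-edges at `S` and one on the remaining ones. -/
noncomputable def glue (π : H → V) (S : Set V)
    (p : ({x // π x ∈ S} → {x // π x ∈ S}) × ({x // π x ∈ Sᶜ} → {x // π x ∈ Sᶜ})) (x : H) : H :=
  if h : π x ∈ S then p.1 ⟨x, h⟩ else p.2 ⟨x, h⟩

section Glue

variable {π : H → V} {S : Set V}
  {p : ({x // π x ∈ S} → {x // π x ∈ S}) × ({x // π x ∈ Sᶜ} → {x // π x ∈ Sᶜ})}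

theorem glue_left (x : {x // π x ∈ S}) : glue π S p x = p.1 x := by
  simp [glue, x.2]

theorem glue_right (x : {x // π x ∈ Sᶜ}) : glue π S p x = p.2 x := by
  have : ¬ π x ∈ S := x.2
  simp [glue, this]

theorem glue_injective : Function.Injective (glue π S) := by
  intro p q h
  refine Prod.ext (funext fun x => Subtype.ext ?_) (funext fun x => Subtype.ext ?_)
  · rw [← glue_left, ← glue_left, h]
  · rw [← glue_right, ← glue_right, h]

theorem isMatching_glue {b : Prop} : IsMatching b π (glue π S p) ↔
    IsMatching b (restr π S) p.1 ∧ IsMatching b (restr π Sᶜ) p.2 := by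
  constructor
  · rintro ⟨⟨h1, h2⟩, h3⟩
    refine ⟨⟨⟨fun x => Subtype.ext ?_, fun x hx => h2 x ?_⟩, fun hb => ⟨fun x hx => ?_, ?_⟩⟩,
      ⟨⟨fun x => Subtype.ext ?_, fun x hx => h2 x ?_⟩, fun hb => ⟨fun x hx => ?_, ?_⟩⟩⟩
    · rw [← glue_left, ← glue_left, h1]
    · rw [glue_left, hx]
    · exact (h3 hb).1 x (by rw [glue_left]; exact congrArg Subtype.val hx)
    · intro x y hxy hf
      have := (h3 hb).2 x y (congrArg Subtype.val hxy)
        (by rw [glue_left, glue_left]; exact congrArg Subtype.val hf)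
      rwa [glue_left, ← Subtype.ext_iff, ← Subtype.ext_iff] at this
    · rw [← glue_right, ← glue_right, h1]
    · rw [glue_right, hx]
    · exact (h3 hb).1 x (by rw [glue_right]; exact congrArg Subtype.val hx)
    · intro x y hxy hf
      have := (h3 hb).2 x y (congrArg Subtype.val hxy)
        (by rw [glue_right, glue_right]; exact congrArg Subtype.val hf)
      rwa [glue_right, ← Subtype.ext_iff, ← Subtype.ext_iff] at this
  · rintro ⟨⟨⟨g1, g2⟩, g3⟩, ⟨⟨h1, h2⟩, h3⟩⟩
    refine ⟨⟨fun x => ?_, fun x => ?_⟩, fun hb => ⟨fun x => ?_, fun x y hxy => ?_⟩⟩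
    · by_cases hx : π x ∈ S
      · lift x to {x // π x ∈ S} using hx
        rw [glue_left, glue_left, g1]
      · lift x to {x // π x ∈ Sᶜ} using hx
        rw [glue_right, glue_right, h1]
    · by_cases hx : π x ∈ S
      · lift x to {x // π x ∈ S} using hx
        rw [glue_left]
        exact fun h => g2 x (Subtype.ext h)
      · lift x to {x // π x ∈ Sᶜ} using hx
        rw [glue_right]
        exact fun h => h2 x (Subtype.ext h)
    · by_cases hx : π x ∈ S
      · lift x to {x // π x ∈ S} using hx
        rw [glue_left]
        exact fun h => (g3 hb).1 x (Subtype.ext h)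
      · lift x to {x // π x ∈ Sᶜ} using hx
        rw [glue_right]
        exact fun h => (h3 hb).1 x (Subtype.ext h)
    · by_cases hx : π x ∈ S
      · have hy : π y ∈ S := hxy ▸ hx
        lift x to {x // π x ∈ S} using hx
        lift y to {x // π x ∈ S} using hy
        rw [glue_left, glue_left, ← Subtype.ext_iff, ← Subtype.ext_iff]
        exact fun h => (g3 hb).2 x y (Subtype.ext hxy) (Subtype.ext h)
      · have hy : π y ∈ Sᶜ := fun h => hx (hxy ▸ h)
        lift x to {x // π x ∈ Sᶜ} using hx
        lift y to {x // π x ∈ Sᶜ} using hy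
        rw [glue_right, glue_right, ← Subtype.ext_iff, ← Subtype.ext_iff]
        exact fun h => (h3 hb).2 x y (Subtype.ext hxy) (Subtype.ext h)

theorem reachable_glue (u : S) (w : V) :
    Relation.ReflTransGen (MAdj π (glue π S p)) u w ↔
      ∃ h : w ∈ S, Relation.ReflTransGen (MAdj (restr π S) p.1) u ⟨w, h⟩ := by
  constructor
  · intro h
    induction h with
    | refl => exact ⟨u.2, .refl⟩
    | tail _ hbc ih =>
      obtain ⟨hb, ih⟩ := ih
      obtain ⟨x, rfl, rfl⟩ := hbc
      lift x to {x // π x ∈ S} using hb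
      have hS : π (glue π S p x) ∈ S := by rw [glue_left]; exact (p.1 x).2
      exact ⟨hS, ih.tail ⟨x, rfl, Subtype.ext (by simp [restr, glue_left])⟩⟩
  · rintro ⟨hw, h⟩
    refine Relation.ReflTransGen.lift (fun s : S => (s : V)) ?_ _ _ h
    rintro _ _ ⟨x, rfl, rfl⟩
    exact ⟨x, rfl, by rw [glue_left]; rfl⟩

theorem isComp_glue (hp : Function.Involutive p.1) (hS : S.Nonempty) :
    IsComp π (glue π S p) S ↔ MConn (restr π S) p.1 := by
  constructor
  · rintro ⟨v, hv⟩
    have hvS : v ∈ S := (hv v).2 .refl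
    have key : ∀ u : S, Relation.ReflTransGen (MAdj (restr π S) p.1) ⟨v, hvS⟩ u := fun u =>
      ((reachable_glue ⟨v, hvS⟩ u).1 ((hv u).1 u.2)).2
    exact fun u w => (reachable_symm hp (key u)).trans (key w)
  · intro h
    obtain ⟨v, hv⟩ := hS
    refine ⟨v, fun u => ?_⟩
    rw [reachable_glue ⟨v, hv⟩ u]
    exact ⟨fun hu => ⟨hu, h _ _⟩, fun hu => hu.1⟩

theorem exists_glue_eq {f : H → H} (hf : Function.Involutive f) (hS : IsComp π f S) :
    ∃ p, glue π S p = f := by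
  have hc : ∀ x, π x ∈ Sᶜ → π (f x) ∈ Sᶜ := fun x hx h => hx (by
    have := hS.map_mem h
    rwa [hf x] at this)
  refine ⟨(fun x => ⟨f x, hS.map_mem x.2⟩, fun x => ⟨f x, hc x x.2⟩), funext fun x => ?_⟩
  by_cases hx : π x ∈ S
  · lift x to {x // π x ∈ S} using hx
    rw [glue_left]
  · lift x to {x // π x ∈ Sᶜ} using hx
    rw [glue_right]

end Glue

theorem ncard_matchings_with_comp (b : Prop) (π : H → V) (S : Set V) (hS : S.Nonempty) :
    {f | IsMatching b π f ∧ IsComp π f S}.ncard =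
      {f | IsMatching b (restr π S) f ∧ MConn (restr π S) f}.ncard *
        {f | IsMatching b (restr π Sᶜ) f}.ncard := by
  rw [← Set.ncard_prod, ← Set.ncard_image_of_injective _ (glue_injective (π := π) (S := S))]
  congr 1
  ext f
  constructor
  · rintro ⟨h1, h2⟩
    obtain ⟨p, rfl⟩ := exists_glue_eq h1.1.1 h2
    obtain ⟨h3, h4⟩ := isMatching_glue.1 h1
    exact ⟨p, ⟨⟨h3, (isComp_glue h3.1.1 hS).1 h2⟩, h4⟩, rfl⟩
  · rintro ⟨p, ⟨⟨h1, h2⟩, h3⟩, rfl⟩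
    exact ⟨isMatching_glue.2 ⟨h1, h3⟩, (isComp_glue h1.1.1 hS).2 h2⟩

section Transport

variable {π : H → V} {π' : H' → V'} (eH : H ≃ H') (eV : V ≃ V')

theorem IsMatching.conj (hπ : ∀ x, π' (eH x) = eV (π x)) {b : Prop} {f : H → H}
    (h : IsMatching b π f) : IsMatching b π' (eH.conj f) := by
  have hπ' : ∀ y, π' y = eV (π (eH.symm y)) := fun y => by rw [← hπ, eH.apply_symm_apply]
  obtain ⟨⟨h1, h2⟩, h3⟩ := h
  refine ⟨⟨fun x => ?_, fun x hx => ?_⟩, fun hb => ⟨fun x hx => ?_, fun x y hxy hf => ?_⟩⟩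
  · simp [Equiv.conj_apply, h1 (eH.symm x)]
  · exact h2 (eH.symm x) (by simpa [Equiv.conj_apply, Equiv.eq_symm_apply] using hx)
  · exact (h3 hb).1 (eH.symm x) (by simpa [Equiv.conj_apply, hπ'] using hx)
  · have := (h3 hb).2 (eH.symm x) (eH.symm y) (by simpa [hπ'] using hxy)
      (by simpa [Equiv.conj_apply, hπ'] using hf)
    simpa [Equiv.conj_apply, Equiv.symm_apply_eq] using this

theorem MConn.conj (hπ : ∀ x, π' (eH x) = eV (π x)) {f : H → H}
    (h : MConn π f) : MConn π' (eH.conj f) := by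
  intro u v
  have := Relation.ReflTransGen.lift (p := MAdj π' (eH.conj f)) eV ?_ _ _ (h (eV.symm u) (eV.symm v))
  · simpa [Function.onFun] using this
  · rintro _ _ ⟨x, rfl, rfl⟩
    exact ⟨eH x, hπ x, by simp [Equiv.conj_apply, hπ]⟩

theorem isMatching_conj (hπ : ∀ x, π' (eH x) = eV (π x)) {b : Prop} {f : H → H} :
    IsMatching b π' (eH.conj f) ↔ IsMatching b π f := by
  refine ⟨fun h => ?_, fun h => h.conj eH eV hπ⟩
  have := h.conj (π' := π) eH.symm eV.symm (fun y => by
    rw [Equiv.eq_symm_apply, ← hπ, eH.apply_symm_apply])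
  rwa [← Equiv.conj_symm, Equiv.symm_apply_apply] at this

theorem mConn_conj (hπ : ∀ x, π' (eH x) = eV (π x)) {f : H → H} :
    MConn π' (eH.conj f) ↔ MConn π f := by
  refine ⟨fun h => ?_, fun h => h.conj eH eV hπ⟩
  have := h.conj (π' := π) eH.symm eV.symm (fun y => by
    rw [Equiv.eq_symm_apply, ← hπ, eH.apply_symm_apply])
  rwa [← Equiv.conj_symm, Equiv.symm_apply_apply] at this

theorem ncard_conj {P : (H → H) → Prop} {Q : (H' → H') → Prop}
    (h : ∀ f, Q (eH.conj f) ↔ P f) : {f | P f}.ncard = {f | Q f}.ncard := by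
  rw [← Set.ncard_image_of_injective _ eH.conj.injective]
  congr 1
  ext f
  constructor
  · rintro ⟨g, hg, rfl⟩
    exact (h g).2 hg
  · intro hf
    refine ⟨eH.conj.symm f, (h _).1 ?_, eH.conj.apply_symm_apply f⟩
    rwa [eH.conj.apply_symm_apply]

end Transport

theorem exists_equiv_of_card_fibers [Finite V] [Finite V'] (d : V → ℕ) (d' : V' → ℕ)
    (h : ∀ i, {v | d v = i}.ncard = {v | d' v = i}.ncard) : ∃ e : V ≃ V', ∀ v, d' (e v) = d v := by
  have hne : ∀ i, Nonempty ({v // d v = i} ≃ {v // d' v = i}) := fun i =>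
    (Finite.card_eq).1 (h i)
  let e := fun i => (hne i).some
  refine ⟨(Equiv.sigmaFiberEquiv d).symm.trans
    ((Equiv.sigmaCongrRight e).trans (Equiv.sigmaFiberEquiv d')), fun v => ?_⟩
  exact (e (d v) ⟨v, rfl⟩).2

/-- The half-edges at the vertices of `S`, grouped by vertex. -/
def halfEdgesAt (d : V → ℕ) (S : Set V) :
    {x : Σ v, Fin (d v) // x.1 ∈ S} ≃ Σ s : S, Fin (d s) where
  toFun x := ⟨⟨x.1.1, x.2⟩, x.1.2⟩
  invFun y := ⟨⟨y.1, y.2⟩, y.1.2⟩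
  left_inv _ := rfl
  right_inv _ := rfl

theorem exists_equiv_halfEdges [Finite V] [Finite V'] (d : V → ℕ) (S : Set V) (d' : V' → ℕ)
    (h : ∀ i, {v | v ∈ S ∧ d v = i}.ncard = {v | d' v = i}.ncard) :
    ∃ (eH : {x : Σ v, Fin (d v) // x.1 ∈ S} ≃ Σ v, Fin (d' v)) (eV : S ≃ V'),
      ∀ x, (eH x).1 = eV (restr Sigma.fst S x) := by
  obtain ⟨e, he⟩ := exists_equiv_of_card_fibers (fun s : S => d s) d' (fun i => by
    rw [← h, ← Set.ncard_image_of_injective _ Subtype.val_injective]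
    congr 1
    ext v
    simp [and_comm])
  refine ⟨(halfEdgesAt d S).trans (Equiv.sigmaCongr e fun s => finCongr (he s).symm), e,
    fun x => rfl⟩

open Classical in
theorem card_subsets_of_type [Fintype V] (d : V → ℕ) (m : ℕ → ℕ) (I : Finset ℕ)
    (hI : ∀ v, d v ∈ I) (hm : ∀ i, i ∉ I → m i = 0) :
    (Finset.univ.filter fun S : Finset V => ∀ i, (S.filter fun v => d v = i).card = m i).card =
      ∏ i ∈ I, Nat.choose (Finset.univ.filter fun v => d v = i).card (m i) := by
  have : (I.pi fun i => Finset.powersetCard (m i) (Finset.univ.filter fun v => d v = i)).card =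
      ∏ i ∈ I, Nat.choose (Finset.univ.filter fun v => d v = i).card (m i) := by
    simp [Finset.card_pi]
  rw [← this]
  refine Finset.card_bij' (fun S _ i _ => S.filter fun v => d v = i)
    (fun F _ => Finset.univ.filter fun v => v ∈ F (d v) (hI v)) ?_ ?_ ?_ ?_
  · intro S hS
    simp only [Finset.mem_filter, Finset.mem_univ, true_and] at hS
    simp only [Finset.mem_pi, Finset.mem_powersetCard]
    exact fun i _ => ⟨Finset.filter_subset_filter _ (Finset.subset_univ _), hS i⟩
  · intro F hF
    simp only [Finset.mem_pi, Finset.mem_powersetCard] at hF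
    simp only [Finset.mem_filter, Finset.mem_univ, true_and]
    intro i
    by_cases hi : i ∈ I
    · rw [← (hF i hi).2]
      congr 1
      ext v
      simp only [Finset.mem_filter, Finset.mem_univ, true_and]
      constructor
      · rintro ⟨h, rfl⟩
        exact h
      · intro h
        have := (hF i hi).1 h
        simp only [Finset.mem_filter, Finset.mem_univ, true_and] at this
        subst this
        exact ⟨h, rfl⟩
    · rw [hm i hi, Finset.card_eq_zero, Finset.filter_eq_empty_iff]
      rintro v _ rfl
      exact hi (hI v)
  · intro S hS
    ext v
    simp
  · intro F hF
    simp only [Finset.mem_pi, Finset.mem_powersetCard] at hF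
    funext i hi
    ext v
    simp only [Finset.mem_filter, Finset.mem_univ, true_and]
    constructor
    · rintro ⟨h, rfl⟩
      exact h
    · intro h
      have := (hF i hi).1 h
      simp only [Finset.mem_filter, Finset.mem_univ, true_and] at this
      subst this
      exact ⟨h, rfl⟩

end Matchings

section Degrees

theorem sum_Icc_le_numV (m : ℕ →₀ ℕ) (j : ℕ) : ∑ k ∈ Finset.Icc 1 j, m k ≤ numV m := by
  calc ∑ k ∈ Finset.Icc 1 j, m k
      = ∑ k ∈ (Finset.Icc 1 j).filter (· ∈ m.support), m k := by
        rw [Finset.sum_filter_of_ne]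
        exact fun k _ h => Finsupp.mem_support_iff.2 h
    _ ≤ ∑ k ∈ m.support, m k := Finset.sum_le_sum_of_subset fun k hk => (Finset.mem_filter.1 hk).2

theorem exists_numV_le_sum_Icc (m : ℕ →₀ ℕ) (h0 : m 0 = 0) :
    ∃ j, numV m ≤ ∑ k ∈ Finset.Icc 1 j, m k := by
  refine ⟨m.support.sup id, Finset.sum_le_sum_of_subset fun k hk => ?_⟩
  refine Finset.mem_Icc.2 ⟨Nat.one_le_iff_ne_zero.2 ?_, Finset.le_sup (f := id) hk⟩
  rintro rfl
  exact Finsupp.mem_support_iff.1 hk h0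

theorem degOf_le_iff (m : ℕ →₀ ℕ) (h0 : m 0 = 0) {u : ℕ} (hu : u < numV m) (j : ℕ) :
    degOf m u ≤ j ↔ u < ∑ k ∈ Finset.Icc 1 j, m k := by
  constructor
  · intro h
    obtain ⟨N, hN⟩ := exists_numV_le_sum_Icc m h0
    have hne : {j : ℕ | u < ∑ k ∈ Finset.Icc 1 j, m k}.Nonempty := ⟨N, hu.trans_le hN⟩
    exact (Nat.sInf_mem hne).trans_le
      (Finset.sum_le_sum_of_subset (Finset.Icc_subset_Icc_right h))
  · exact fun h => Nat.sInf_le h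

theorem ncard_degOf_le (m : ℕ →₀ ℕ) (h0 : m 0 = 0) (j : ℕ) :
    {u : Fin (numV m) | degOf m u ≤ j}.ncard = ∑ k ∈ Finset.Icc 1 j, m k := by
  have : {u : Fin (numV m) | degOf m u ≤ j} =
      Set.range (Fin.castLE (sum_Icc_le_numV m j)) := by
    ext u
    simp only [Set.mem_ofPred_eq, degOf_le_iff m h0 u.2, Set.mem_range]
    exact ⟨fun h => ⟨⟨u, h⟩, rfl⟩, by rintro ⟨y, rfl⟩; exact y.2⟩
  rw [this, ← Set.image_univ, Set.ncard_image_of_injective _ (Fin.castLE_injective _),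
    Set.ncard_univ, Nat.card_fin]

theorem ncard_degOf_eq (m : ℕ →₀ ℕ) (h0 : m 0 = 0) (i : ℕ) :
    {u : Fin (numV m) | degOf m u = i}.ncard = m i := by
  cases i with
  | zero => simpa [h0] using ncard_degOf_le m h0 0
  | succ j =>
    have h1 := ncard_degOf_le m h0 (j + 1)
    rw [Finset.sum_Icc_succ_top (by omega), ← ncard_degOf_le m h0 j] at h1
    have h2 : {u : Fin (numV m) | degOf m u ≤ j + 1} =
        {u : Fin (numV m) | degOf m u ≤ j} ∪ {u : Fin (numV m) | degOf m u = j + 1} := by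
      ext u
      simp only [Set.mem_ofPred_eq, Set.mem_union]
      omega
    rw [h2, Set.ncard_union_eq] at h1
    · omega
    · rw [Set.disjoint_left]
      intro u hu hu'
      simp only [Set.mem_ofPred_eq] at hu hu'
      omega

end Degrees

theorem adj_eq_mAdj (m : ℕ →₀ ℕ) (f : HalfEdges m → HalfEdges m) :
    adj m f = MAdj Sigma.fst f := by
  funext u v
  refine propext ⟨?_, ?_⟩
  · rintro ⟨j, j', h⟩
    exact ⟨⟨u, j⟩, rfl, by rw [h]⟩
  · rintro ⟨⟨u, j⟩, rfl, rfl⟩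
    exact ⟨j, (f ⟨u, j⟩).2, rfl⟩

open Classical in
/-- The decomposition for matchings that are required to be simple when `b` holds. -/
theorem ncard_matchings_with_comp_of_type (b : Prop) (nn m : ℕ →₀ ℕ) (hnn0 : nn 0 = 0)
    (hle : m ≤ nn) (hhalf : numV nn < 2 * numV m) :
    {f | IsMatching b (Sigma.fst : HalfEdges nn → _) f ∧ HasCompOfType nn f m}.ncard =
      (∏ᶠ i : ℕ, Nat.choose (nn i) (m i)) *
        {f | IsMatching b (Sigma.fst : HalfEdges m → _) f ∧
          MConn (Sigma.fst : HalfEdges m → _) f}.ncard *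
        {f | IsMatching b (Sigma.fst : HalfEdges (nn - m) → _) f}.ncard := by
  have hm0 : m 0 = 0 := Nat.le_zero.1 ((hle 0).trans_eq hnn0)
  have hsub0 : (nn - m) 0 = 0 := by simp [hnn0]
  let d : Fin (numV nn) → ℕ := fun v => degOf nn v
  have hd : ∀ i, (Finset.univ.filter fun v => d v = i).card = nn i := fun i => by
    rw [← ncard_degOf_eq nn hnn0 i, ← Set.ncard_coe_finset]
    simp [d]
  let T := Finset.univ.filter fun S : Finset (Fin (numV nn)) =>
    ∀ i, (S.filter fun v => d v = i).card = m i
  have hdI : ∀ v, d v ∈ nn.support := fun v => by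
    rw [Finsupp.mem_support_iff, ← hd, ← Nat.pos_iff_ne_zero, Finset.card_pos]
    exact ⟨v, by simp⟩
  have hTcard : T.card = ∏ᶠ i : ℕ, Nat.choose (nn i) (m i) := by
    rw [card_subsets_of_type d m nn.support hdI,
      finprod_eq_prod_of_mulSupport_subset (s := nn.support)]
    · simp only [hd]
    · intro i hi
      simp only [Function.mem_mulSupport] at hi
      simp only [Finset.mem_coe, Finsupp.mem_support_iff]
      intro h
      have := hle i
      rw [h, Nat.le_zero] at this
      simp [h, this] at hi
    · intro i hi
      have := hle i
      rwa [Finsupp.notMem_support_iff.1 hi, Nat.le_zero] at this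
  have hTS : ∀ S ∈ T, S.card = numV m := by
    intro S hS
    have hS := (Finset.mem_filter.1 hS).2
    rw [Finset.card_eq_sum_card_fiberwise (f := d) (t := nn.support) (fun v _ => hdI v)]
    simp only [hS]
    exact (Finset.sum_subset (Finsupp.support_mono hle)
      fun i _ hi => Finsupp.notMem_support_iff.1 hi).symm
  have hunion : {f | IsMatching b (Sigma.fst : HalfEdges nn → _) f ∧ HasCompOfType nn f m} =
      ↑(T.biUnion fun S => {f | IsMatching b (Sigma.fst : HalfEdges nn → _) f ∧
        IsComp Sigma.fst f (S : Set (Fin (numV nn)))}.toFinset) := by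
    ext f
    simp only [Set.mem_ofPred_eq, Finset.coe_biUnion, Set.coe_toFinset, Set.mem_iUnion,
      Finset.mem_coe, exists_prop]
    constructor
    · rintro ⟨hf, v, hv⟩
      refine ⟨(component nn f v).toFinset, Finset.mem_filter.2 ⟨Finset.mem_univ _, fun i => ?_⟩,
        hf, v, fun u => ?_⟩
      · rw [← hv i, compType, ← Set.ncard_coe_finset]
        simp [d, Set.ofPred_and]
      · rw [Finset.mem_coe, Set.mem_toFinset, ← adj_eq_mAdj]
        rfl
    · rintro ⟨S, hS, hf, v, hv⟩
      refine ⟨hf, v, fun i => ?_⟩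
      rw [← (Finset.mem_filter.1 hS).2 i, compType, ← Set.ncard_coe_finset]
      congr 1
      ext u
      simp [d, component, adj_eq_mAdj, ← hv]
  rw [hunion, Set.ncard_coe_finset, Finset.card_biUnion, ← hTcard, mul_assoc]
  · refine Finset.sum_const_nat fun S hS => ?_
    have hcard := hTS S hS
    have hS' := (Finset.mem_filter.1 hS).2
    have hne : (S : Set (Fin (numV nn))).Nonempty := by
      rw [Finset.coe_nonempty, ← Finset.card_pos]
      omega
    have hSi : ∀ i, {v | v ∈ (S : Set (Fin (numV nn))) ∧ d v = i}.ncard = m i := fun i => by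
      rw [← hS' i, ← Set.ncard_coe_finset]
      simp
    rw [← Set.ncard_eq_toFinset_card', ncard_matchings_with_comp b _ _ hne]
    obtain ⟨eH, eV, he⟩ := exists_equiv_halfEdges d S (fun v : Fin (numV m) => degOf m v)
      (fun i => by rw [ncard_degOf_eq m hm0, hSi])
    obtain ⟨eH', eV', he'⟩ := exists_equiv_halfEdges d (S : Set (Fin (numV nn)))ᶜ
      (fun v : Fin (numV (nn - m)) => degOf (nn - m) v) (fun i => by
        rw [ncard_degOf_eq _ hsub0, Finsupp.tsub_apply, ← hSi i, ← hd i, ← Set.ncard_coe_finset,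
          ← Set.ncard_sdiff]
        · congr 1
          ext v
          simp
          tauto
        · intro v hv
          simpa using hv.2)
    congr 1
    · exact ncard_conj eH fun f =>
        and_congr (isMatching_conj eH eV he) (mConn_conj eH eV he)
    · exact ncard_conj eH' fun f => isMatching_conj eH' eV' he'
  · intro S hS S' hS' hne
    rw [Function.onFun, Finset.disjoint_left]
    intro f hf hf'
    simp only [Set.mem_toFinset, Set.mem_ofPred_eq] at hf hf'
    have hdisj : ¬ Disjoint S S' := fun h => by
      have h1 := Finset.card_le_univ (S ∪ S')
      rw [Finset.card_union_of_disjoint h, hTS S hS, hTS S' hS', Fintype.card_fin] at h1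
      omega
    obtain ⟨w, hw, hw'⟩ := Finset.not_disjoint_iff.1 hdisj
    exact hne (Finset.coe_injective (hf.2.eq_of_mem hf.1.1.1 hf'.2 hw hw'))

/-- Corollary 4.2 of the paper: if `m ≤ n` componentwise and
`Σ_i m_i > (Σ_i n_i)/2`, then `|𝒞_n^m| = binom(n,m)·|𝒞c_m|·|𝒞_{n−m}|` and
`|𝒮_n^m| = binom(n,m)·|𝒮c_m|·|𝒮_{n−m}|`. -/
theorem connected_component_decomposition
    (nn m : ℕ →₀ ℕ) (hnn0 : nn 0 = 0) (heven : Even (totalDeg nn))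
    (hle : m ≤ nn) (hhalf : numV nn < 2 * numV m) :
    cCcomp nn m = (∏ᶠ i : ℕ, Nat.choose (nn i) (m i)) * cCc m * cC (nn - m)
    ∧ cScomp nn m = (∏ᶠ i : ℕ, Nat.choose (nn i) (m i)) * cSc m * cS (nn - m) := by
  have hconn (m : ℕ →₀ ℕ) (f : HalfEdges m → HalfEdges m) :
      IsConn m f ↔ MConn Sigma.fst f := by
    rw [IsConn, MConn, adj_eq_mAdj]
  constructor
  · have := ncard_matchings_with_comp_of_type False nn m hnn0 hle hhalf
    simpa only [cCcomp, cCc, cC, hconn, IsConfig, IsMatching, false_imp_iff, and_true] using this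
  · have := ncard_matchings_with_comp_of_type True nn m hnn0 hle hhalf
    simpa only [cScomp, cSc, cS, hconn, IsConfig, IsSimple, IsMatching, true_imp_iff, and_assoc]
      using this


end PaperCM
end

section
/- Assume Conditions (a) and (b) and that μ_p > 2. Then there exists ε′ > 0 such that for every η > 0 there exists ε″ ∈ (0, ε′] such that for all ε ∈ (0, ε″): limsup_{n→∞} (1/n)·log( |𝒞_{n(n)}^{𝒩^ε}| / |𝒞c_{n(n)}| ) ≤ η, and likewise limsup_{n→∞} (1/n)·log( |𝒮_{n(n)}^{𝒩^ε}| / |𝒮c_{n(n)}| ) ≤ η. (Since 𝒞c_{n(n)} ⊆ 𝒞_{n(n)}^{𝒩^ε}, both ratios are at least 1, so this says |𝒞_{n(n)}^{𝒩^ε}| = e^{δ(ε)n}·|𝒞c_{n(n)}| and |𝒮_{n(n)}^{𝒩^ε}| = e^{δ(ε)n}·|𝒮c_{n(n)}| with δ(ε) → 0 as ε ↓ 0.) -/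
namespace PaperCM

/-- Two disjoint finite sets of the same size are exchanged by an involution that fixes
everything else. -/
theorem exists_involutive_exchange {H : Type*} (B X : Finset H) (hBX : Disjoint B X)
    (hc : B.card = X.card) :
    ∃ s : H → H, Function.Involutive s ∧ (∀ b ∈ B, s b ∈ X) ∧ (∀ x ∈ X, s x ∈ B) ∧
      ∀ h, h ∉ B → h ∉ X → s h = h := by
  classical
  let e : B ≃ X := Finset.equivOfCardEq hc
  have hX : ∀ x ∈ X, x ∉ B := fun x hx hb => Finset.disjoint_left.1 hBX hb hx
  let s : H → H := fun h =>
    if hB : h ∈ B then e ⟨h, hB⟩ else if hX : h ∈ X then e.symm ⟨h, hX⟩ else h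
  have sB : ∀ b (hb : b ∈ B), s b = e ⟨b, hb⟩ := fun b hb => by simp [s, hb]
  have sX : ∀ x (hx : x ∈ X), s x = e.symm ⟨x, hx⟩ := fun x hx => by simp [s, hx, hX x hx]
  have sO : ∀ h, h ∉ B → h ∉ X → s h = h := fun h h1 h2 => by simp [s, h1, h2]
  refine ⟨s, fun h => ?_, fun b hb => ?_, fun x hx => ?_, sO⟩
  · by_cases hb : h ∈ B
    · rw [sB h hb, sX _ (e ⟨h, hb⟩).2]; simp
    · by_cases hx : h ∈ X
      · rw [sX h hx, sB _ (e.symm ⟨h, hx⟩).2]; simp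
      · rw [sO h hb hx, sO h hb hx]
  · rw [sB b hb]; exact (e _).2
  · rw [sX x hx]; exact (e.symm _).2

open Classical in
/-- A fixed involution exchanging `B` and `X` whenever there is one; the identity otherwise. -/
noncomputable def exchange {H : Type*} (B X : Finset H) : H → H :=
  if h : ∃ s : H → H, Function.Involutive s ∧ (∀ b ∈ B, s b ∈ X) ∧ (∀ x ∈ X, s x ∈ B) ∧
      ∀ h, h ∉ B → h ∉ X → s h = h then h.choose else id

theorem exchange_involutive {H : Type*} (B X : Finset H) :
    Function.Involutive (exchange B X) := by
  unfold exchange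
  split_ifs with h
  · exact h.choose_spec.1
  · exact fun _ => rfl

theorem exchange_spec {H : Type*} {B X : Finset H} (hBX : Disjoint B X)
    (hc : B.card = X.card) :
    (∀ b ∈ B, exchange B X b ∈ X) ∧ (∀ x ∈ X, exchange B X x ∈ B) ∧
      ∀ h, h ∉ B → h ∉ X → exchange B X h = h := by
  have h := exists_involutive_exchange B X hBX hc
  rw [exchange, dif_pos h]
  exact h.choose_spec.2

/-- The switching of `f` along `B` and `X`: half-edges of `B` and `X` are relabelled. -/
noncomputable def switching {H : Type*} (B X : Finset H) (f : H → H) : H → H :=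
  exchange B X ∘ f ∘ exchange B X

theorem switching_switching {H : Type*} (B X : Finset H) (f : H → H) :
    switching B X (switching B X f) = f := by
  funext h
  simp [switching, exchange_involutive B X _]

theorem switching_involutive {H : Type*} (B X : Finset H) {f : H → H}
    (hf : Function.Involutive f) : Function.Involutive (switching B X f) := by
  intro h
  simp [switching, exchange_involutive B X _, hf _]

theorem switching_ne {H : Type*} (B X : Finset H) {f : H → H}
    (hf : ∀ h, f h ≠ h) (h : H) : switching B X f h ≠ h := by
  intro hh
  apply hf (exchange B X h)
  have := congrArg (exchange B X) hh
  simpa [switching, exchange_involutive B X _] using this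

/-- Vertices reachable from a root by a relation admit a rank that strictly decreases towards
the root. -/
theorem exists_rank_of_reflTransGen {V : Type*} (r : V → V → Prop) (v : V) :
    ∃ rank : V → ℕ, ∀ w, Relation.ReflTransGen r v w → w ≠ v →
      ∃ u, Relation.ReflTransGen r v u ∧ r u w ∧ rank u < rank w := by
  obtain ⟨R, hR0, hRs⟩ : ∃ R : ℕ → V → Prop, (∀ w, R 0 w ↔ w = v) ∧
      ∀ n w, R (n + 1) w ↔ ∃ u, R n u ∧ r u w :=
    ⟨fun n => Nat.rec (fun w => w = v) (fun _ P w => ∃ u, P u ∧ r u w) n,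
      fun _ => Iff.rfl, fun _ _ => Iff.rfl⟩
  have hR : ∀ n w, R n w → Relation.ReflTransGen r v w := by
    intro n
    induction n with
    | zero => intro w hw; rw [(hR0 w).1 hw]
    | succ n ih =>
      intro w hw
      obtain ⟨u, hu, huw⟩ := (hRs n w).1 hw
      exact (ih u hu).tail huw
  have hR' : ∀ w, Relation.ReflTransGen r v w → {n | R n w}.Nonempty := by
    intro w hw
    induction hw with
    | refl => exact ⟨0, (hR0 v).2 rfl⟩
    | tail _ h ih => obtain ⟨n, hn⟩ := ih; exact ⟨n + 1, (hRs _ _).2 ⟨_, hn, h⟩⟩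
  refine ⟨fun w => sInf {n | R n w}, fun w hw hne => ?_⟩
  have hmem : R (sInf {n | R n w}) w := Nat.sInf_mem (hR' w hw)
  rcases hk : sInf {n | R n w} with _ | k
  · rw [hk, hR0] at hmem; exact absurd hmem hne
  · rw [hk, hRs] at hmem
    obtain ⟨u, hu, huw⟩ := hmem
    refine ⟨u, hR k u hu, huw, ?_⟩
    simp only [hk]
    exact Nat.lt_succ_of_le (Nat.sInf_le hu)

/-- Adjacency of vertices induced by a map on half-edges, `π` giving the vertex of a
half-edge. -/
def HAdj {H V : Type*} (π : H → V) (f : H → H) (u v : V) : Prop :=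
  ∃ h, π h = u ∧ π (f h) = v

/-- A spanning tree of the component of `v`, given by at most one half-edge per vertex. -/
theorem exists_spanning_halfEdges {H V : Type*} [Fintype V] (π : H → V) (f : H → H) (v : V) :
    ∃ E : Finset H, E.card ≤ Fintype.card V ∧ ∀ w, Relation.ReflTransGen (HAdj π f) v w →
      Relation.ReflTransGen (fun a b => ∃ h ∈ E, π h = a ∧ π (f h) = b) v w := by
  classical
  obtain ⟨rank, hrank⟩ := exists_rank_of_reflTransGen (HAdj π f) v
  have key : ∀ w, ∃ E : Finset H, E.card ≤ 1 ∧
      (Relation.ReflTransGen (HAdj π f) v w → w ≠ v →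
        ∃ h ∈ E, Relation.ReflTransGen (HAdj π f) v (π h) ∧ π (f h) = w ∧
          rank (π h) < rank w) := by
    intro w
    by_cases hw : Relation.ReflTransGen (HAdj π f) v w ∧ w ≠ v
    · obtain ⟨u, hu, ⟨h, rfl, hh⟩, hlt⟩ := hrank w hw.1 hw.2
      exact ⟨{h}, by simp, fun _ _ => ⟨h, by simp, hu, hh, hlt⟩⟩
    · exact ⟨∅, by simp, fun h1 h2 => absurd ⟨h1, h2⟩ hw⟩
  choose E hE hE' using key
  refine ⟨Finset.univ.biUnion E, ?_, ?_⟩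
  · simpa using Finset.card_biUnion_le_card_mul Finset.univ E 1 (fun w _ => hE w)
  · intro w
    induction hn : rank w using Nat.strong_induction_on generalizing w with
    | _ n ih =>
      intro hw
      by_cases hv : w = v
      · rw [hv]
      · obtain ⟨h, hh, hr, hfw, hlt⟩ := hE' w hw hv
        exact (ih _ (hn ▸ hlt) _ rfl hr).tail
          ⟨h, Finset.mem_biUnion.2 ⟨w, Finset.mem_univ _, hh⟩, rfl, hfw⟩

/-- A set closed under a fixed-point-free involution contains a set of any size up to half its
own that is disjoint from its image. -/
theorem exists_subset_card_image_notMem {H : Type*} {f : H → H} (hf : Function.Involutive f)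
    (hf' : ∀ h, f h ≠ h) (R : Finset H) (k : ℕ) (hk : 2 * k ≤ R.card) :
    ∃ X ⊆ R, X.card = k ∧ ∀ x ∈ X, f x ∉ X := by
  classical
  induction k with
  | zero => exact ⟨∅, by simp, by simp, by simp⟩
  | succ k ih =>
    obtain ⟨X, hXR, hXc, hX⟩ := ih (by omega)
    have h1 : (X ∪ X.image f).card < R.card := by
      have := Finset.card_union_le X (X.image f)
      have := Finset.card_image_le (s := X) (f := f)
      omega
    obtain ⟨x, hxR, hx⟩ := Finset.exists_mem_notMem_of_card_lt_card h1
    simp only [Finset.mem_union, Finset.mem_image, not_or, not_exists, not_and] at hx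
    refine ⟨insert x X, Finset.insert_subset hxR hXR, by simp [hx.1, hXc], fun y hy => ?_⟩
    rw [Finset.mem_insert] at hy
    rw [Finset.mem_insert, not_or]
    rcases hy with rfl | hy
    · exact ⟨hf' y, fun h => hx.2 _ h (hf y)⟩
    · exact ⟨hx.2 y hy, hX y hy⟩

/-- A system of representatives, as half-edges, of the components other than that of `v`. -/
theorem exists_representatives {H V : Type*} [Fintype H] {π : H → V}
    (hπ : Function.Surjective π) {r : V → V → Prop} (hr : Equivalence r) (v : V) :
    ∃ B : Finset H, (∀ b ∈ B, ¬ r v (π b)) ∧ (∀ b ∈ B, ∀ b' ∈ B, r (π b) (π b') → b = b') ∧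
      ∀ u, ¬ r v u → ∃ b ∈ B, r (π b) u := by
  classical
  let S : Setoid V := ⟨r, hr⟩
  choose σ hσ using hπ
  have hout : ∀ u, r (Quotient.out (Quotient.mk S u)) u := fun u => Quotient.mk_out (s := S) u
  refine ⟨Finset.univ.filter fun h => ¬ r v (π h) ∧
    σ (Quotient.out (Quotient.mk S (π h))) = h, ?_, ?_, ?_⟩
  · simp +contextual
  · intro b hb b' hb' hbb
    simp only [Finset.mem_filter, Finset.mem_univ, true_and] at hb hb'
    have : Quotient.mk S (π b) = Quotient.mk S (π b') := Quotient.sound hbb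
    rw [← hb.2, ← hb'.2, this]
  · intro u hu
    have h1 : r (π (σ (Quotient.out (Quotient.mk S u)))) u := by rw [hσ]; exact hout u
    refine ⟨σ (Quotient.out (Quotient.mk S u)), ?_, h1⟩
    simp only [Finset.mem_filter, Finset.mem_univ, true_and]
    refine ⟨fun h => hu (hr.trans h h1), ?_⟩
    rw [show Quotient.mk S (π (σ (Quotient.out (Quotient.mk S u)))) = Quotient.mk S u from
      Quotient.sound h1]

/-- The subsets of size at most `k` of a finite type, counted by an exponential tilt. -/
theorem card_finset_card_le_mul_pow_le (H : Type*) [Fintype H] (k : ℕ) {t : ℝ}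
    (ht : 0 < t) (ht1 : t ≤ 1) :
    ((Finset.univ.filter fun S : Finset H => S.card ≤ k).card : ℝ) * t ^ k
      ≤ (1 + t) ^ Fintype.card H := by
  classical
  have h := Finset.sum_pow_mul_eq_add_pow t 1 (Finset.univ : Finset H)
  simp only [one_pow, mul_one, Finset.powerset_univ, Finset.card_univ] at h
  rw [add_comm 1 t, ← h, ← nsmul_eq_mul]
  refine (Finset.card_nsmul_le_sum _ _ _ fun S hS => ?_).trans
    (Finset.sum_le_sum_of_subset_of_nonneg (Finset.filter_subset _ _)
      fun S _ _ => by positivity)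
  exact pow_le_pow_of_le_one ht.le ht1 (by simpa using hS)

/-- No self-loops and no multiple edges, for a map on half-edges. -/
def HSimple {H V : Type*} (π : H → V) (f : H → H) : Prop :=
  (∀ x, π (f x) ≠ π x) ∧ ∀ x y, π x = π y → π (f x) = π (f y) → x = y ∨ x = f y

theorem hAdj_reflTransGen_equivalence {H V : Type*} (π : H → V) {f : H → H}
    (hf : Function.Involutive f) : Equivalence (Relation.ReflTransGen (HAdj π f)) := by
  have hs : Std.Symm (HAdj π f) :=
    ⟨by rintro _ _ ⟨h, rfl, rfl⟩; exact ⟨f h, rfl, by rw [hf]⟩⟩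
  exact ⟨fun _ => .refl, fun h => Relation.ReflTransGen.stdSymm.symm _ _ h,
    fun h h' => h.trans h'⟩

open Classical in
/-- If the component of `v` has enough half-edges compared with the number of vertices and the
number of half-edges outside it, some switching connects everything, and keeps simplicity. -/
theorem exists_connecting_switching {H V : Type*} [Fintype H] [Fintype V] {π : H → V}
    (hπ : Function.Surjective π) {f : H → H} (hf : Function.Involutive f)
    (hf' : ∀ h, f h ≠ h) (v : V) {out : ℕ}
    (hout : (Finset.univ.filter fun h =>
      ¬ Relation.ReflTransGen (HAdj π f) v (π h)).card ≤ out)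
    (hin : 2 * Fintype.card V + 2 * out ≤
      (Finset.univ.filter fun h => Relation.ReflTransGen (HAdj π f) v (π h)).card) :
    ∃ B X : Finset H, B.card ≤ out ∧ X.card ≤ out ∧
      (∀ u w, Relation.ReflTransGen (HAdj π (switching B X f)) u w) ∧
      (HSimple π f → HSimple π (switching B X f)) := by
  have hr := hAdj_reflTransGen_equivalence π hf
  have hrf : ∀ h, Relation.ReflTransGen (HAdj π f) (π h) (π (f h)) :=
    fun h => .single ⟨h, rfl, rfl⟩
  obtain ⟨E, hE, hEr⟩ := exists_spanning_halfEdges π f v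
  obtain ⟨B, hBv, hBB, hBu⟩ := exists_representatives hπ hr v
  set r := Relation.ReflTransGen (HAdj π f) with hrdef
  have hrf' : ∀ h, r v (π (f h)) ↔ r v (π h) :=
    fun h => ⟨fun h' => hr.trans h' (hr.symm (hrf h)), fun h' => hr.trans h' (hrf h)⟩
  have hBc : B.card ≤ out :=
    (Finset.card_le_card fun b hb => by simpa using hBv b hb).trans hout
  obtain ⟨X, hXR, hXc, hXf⟩ := exists_subset_card_image_notMem hf hf'
    ((Finset.univ.filter fun h => r v (π h)) \ (E ∪ E.image f)) B.card (by
      have h1 := Finset.le_card_sdiff (E ∪ E.image f) (Finset.univ.filter fun h => r v (π h))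
      have h2 := Finset.card_union_le E (E.image f)
      have h3 := Finset.card_image_le (s := E) (f := f)
      omega)
  have hXv : ∀ x ∈ X, r v (π x) := fun x hx => by
    have := hXR hx
    simp only [Finset.mem_sdiff, Finset.mem_filter, Finset.mem_univ, true_and] at this
    exact this.1
  have hXE : ∀ x ∈ X, x ∉ E ∧ f x ∉ E := fun x hx => by
    have := hXR hx
    simp only [Finset.mem_sdiff, Finset.mem_union, Finset.mem_image, not_or, not_exists,
      not_and] at this
    exact ⟨this.2.1, fun h => this.2.2 _ h (hf x)⟩
  obtain ⟨sB, sX, sO⟩ := exchange_spec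
    (Finset.disjoint_left.2 fun b hb hx => hBv b hb (hXv b hx)) hXc.symm
  have hBf : ∀ b ∈ B, f b ∉ B := fun b hb hfb => hf' b (hBB b hb _ hfb (hrf b)).symm
  have sfB : ∀ b ∈ B, exchange B X (f b) = f b := fun b hb =>
    sO _ (hBf b hb) fun h => hBv b hb ((hrf' b).1 (hXv _ h))
  have sfX : ∀ x ∈ X, exchange B X (f x) = f x := fun x hx =>
    sO _ (fun h => hBv _ h ((hrf' x).2 (hXv x hx))) (hXf x hx)
  set g := switching B X f with hg
  have hginv : Function.Involutive g := switching_involutive B X hf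
  have gB : ∀ b ∈ B, g b = f (exchange B X b) := fun b hb => sfX _ (sB b hb)
  have gX : ∀ x ∈ X, g x = f (exchange B X x) := fun x hx => sfB _ (sX x hx)
  have gfB : ∀ a, f a ∈ B → g a = exchange B X (f a) := fun a ha => by
    have := sfB _ ha
    rw [hf] at this
    simp [hg, switching, this]
  have gfX : ∀ a, f a ∈ X → g a = exchange B X (f a) := fun a ha => by
    have := sfX _ ha
    rw [hf] at this
    simp [hg, switching, this]
  have gO : ∀ h, ¬ (h ∈ B ∨ f h ∈ B) → ¬ (h ∈ X ∨ f h ∈ X) → g h = f h := by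
    intro h h1 h2
    rw [not_or] at h1 h2
    simp [hg, switching, sO h h1.1 h2.1, sO _ h1.2 h2.2]
  have outer : ∀ h, (h ∈ B ∨ f h ∈ B) → ¬ r v (π h) := by
    rintro h (h1 | h1)
    · exact hBv h h1
    · exact fun h2 => hBv _ h1 ((hrf' h).2 h2)
  have inner : ∀ h, (h ∈ X ∨ f h ∈ X) → r v (π h) := by
    rintro h (h1 | h1)
    · exact hXv h h1
    · exact (hrf' h).1 (hXv _ h1)
  have outer_g : ∀ h, (h ∈ B ∨ f h ∈ B) → (g h ∈ X ∨ f (g h) ∈ X) := by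
    rintro h (h1 | h1)
    · right; rw [gB h h1, hf]; exact sB h h1
    · left; rw [gfB h h1]; exact sB _ h1
  have inner_g : ∀ h, (h ∈ X ∨ f h ∈ X) → (g h ∈ B ∨ f (g h) ∈ B) := by
    rintro h (h1 | h1)
    · right; rw [gX h h1, hf]; exact sX h h1
    · left; rw [gfX h h1]; exact sX _ h1
  have hstep : ∀ h, Relation.ReflTransGen (HAdj π g) (π h) (π (g h)) :=
    fun h => .single ⟨h, rfl, rfl⟩
  have hgr := hAdj_reflTransGen_equivalence π hginv
  have hconn_in : ∀ w, r v w → Relation.ReflTransGen (HAdj π g) v w := by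
    intro w hw
    have hcomp : ∀ w, Relation.ReflTransGen (fun a b => ∃ h ∈ E, π h = a ∧ π (f h) = b) v w →
        r v w ∧ Relation.ReflTransGen (HAdj π g) v w := by
      intro w hw
      induction hw with
      | refl => exact ⟨.refl, .refl⟩
      | tail _ hh ih =>
        obtain ⟨h, hhE, rfl, rfl⟩ := hh
        refine ⟨(hrf' h).2 ih.1, ?_⟩
        have : g h = f h := gO h (fun h' => outer h h' ih.1) (by
          rintro (h' | h')
          · exact (hXE _ h').1 hhE
          · exact (hXE _ h').2 (by rwa [hf]))
        rw [← this]
        exact ih.2.trans (hstep h)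
    exact (hcomp w (hEr w hw)).2
  have hconn_outer : ∀ h, (h ∈ B ∨ f h ∈ B) → Relation.ReflTransGen (HAdj π g) v (π h) := by
    intro h hh
    have := hconn_in _ (inner _ (outer_g h hh))
    exact this.trans (hgr.symm (hstep h))
  have hconn : ∀ u, Relation.ReflTransGen (HAdj π g) v u := by
    intro u
    by_cases hu : r v u
    · exact hconn_in u hu
    · obtain ⟨b, hb, hbu⟩ := hBu u hu
      have hcomp : ∀ w, r (π b) w → Relation.ReflTransGen (HAdj π g) v w := by
        intro w hw
        induction hw with
        | refl => exact hconn_outer b (.inl hb)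
        | @tail _ _ hbh hh ih =>
          obtain ⟨h, rfl, rfl⟩ := hh
          by_cases ho : h ∈ B ∨ f h ∈ B
          · exact hconn_outer (f h) (by rw [hf]; exact ho.symm)
          · rw [← gO h ho fun hi => hBv b hb (hr.trans (inner h hi) (hr.symm hbh))]
            exact ih.trans (hstep h)
      exact hcomp u hbu
  refine ⟨B, X, hBc, hXc ▸ hBc, fun u w => (hgr.symm (hconn u)).trans (hconn w), ?_⟩
  change HSimple π f → HSimple π g
  rintro ⟨hloop, hmult⟩
  have outer_inj : ∀ h h', (h ∈ B ∨ f h ∈ B) → (h' ∈ B ∨ f h' ∈ B) → π h = π h' → h = h' := by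
    rintro h h' (h1 | h1) (h2 | h2) hh
    · exact hBB h h1 h' h2 (hh ▸ .refl)
    · have := hBB h h1 _ h2 (hh ▸ hrf h')
      exact absurd (by rw [← this, hh]) (hloop h')
    · have := hBB h' h2 _ h1 (hh ▸ hrf h)
      exact absurd (by rw [← this, hh]) (hloop h)
    · exact hf.injective (hBB _ h1 _ h2 (hr.trans (hr.symm (hrf h)) (hh ▸ hrf h')))
  have cross : ∀ h, ((h ∈ B ∨ f h ∈ B) ∨ (h ∈ X ∨ f h ∈ X)) ↔
      ¬ (r v (π (g h)) ↔ r v (π h)) := by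
    intro h
    constructor
    · rintro (h1 | h1)
      · have h2 := outer h h1
        have h3 := inner _ (outer_g h h1)
        tauto
      · have h2 := inner h h1
        have h3 := outer _ (inner_g h h1)
        tauto
    · intro h1
      by_contra h2
      rw [not_or] at h2
      exact h1 (by rw [gO h h2.1 h2.2, hrf'])
  refine ⟨fun x hx => ?_, fun x y hxy hgxy => ?_⟩
  · have h1 : ¬ ((x ∈ B ∨ f x ∈ B) ∨ (x ∈ X ∨ f x ∈ X)) := by rw [cross, hx]; tauto
    rw [not_or] at h1
    rw [gO x h1.1 h1.2] at hx
    exact hloop x hx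
  · have hiff : ((x ∈ B ∨ f x ∈ B) ∨ (x ∈ X ∨ f x ∈ X)) ↔
        ((y ∈ B ∨ f y ∈ B) ∨ (y ∈ X ∨ f y ∈ X)) := by rw [cross, cross, hxy, hgxy]
    by_cases hx : (x ∈ B ∨ f x ∈ B) ∨ (x ∈ X ∨ f x ∈ X)
    · left
      rcases hx with hxo | hxi
      · rcases hiff.1 (.inl hxo) with hyo | hyi
        · exact outer_inj x y hxo hyo hxy
        · exact absurd (hxy ▸ inner y hyi) (outer x hxo)
      · rcases hiff.1 (.inr hxi) with hyo | hyi
        · exact absurd (hxy ▸ inner x hxi) (outer y hyo)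
        · exact hginv.injective (outer_inj _ _ (inner_g x hxi) (inner_g y hyi) hgxy)
    · have hy := mt hiff.2 hx
      rw [not_or] at hx hy
      rw [gO x hx.1 hx.2, gO y hy.1 hy.2] at hgxy
      rw [gO y hy.1 hy.2]
      exact hmult x y hxy hgxy

/-- If every element of `A` can be switched into `T` along sets of size at most `k`, then `A`
is larger than `T` by at most the number of pairs of such sets. -/
theorem ncard_le_of_switching {H : Type*} [Fintype H] (k : ℕ) (A T : Set (H → H))
    (h : ∀ f ∈ A, ∃ B X : Finset H, B.card ≤ k ∧ X.card ≤ k ∧ switching B X f ∈ T) :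
    A.ncard ≤ T.ncard * (Finset.univ.filter fun S : Finset H => S.card ≤ k).card ^ 2 := by
  classical
  choose! B X hB hX hT using h
  set F : Finset (Finset H) := Finset.univ.filter fun S : Finset H => S.card ≤ k with hF
  have h1 : A.ncard ≤ (T ×ˢ ((F : Set (Finset H)) ×ˢ (F : Set (Finset H)))).ncard := by
    refine Set.ncard_le_ncard_of_injOn (fun f => (switching (B f) (X f) f, B f, X f))
      (fun f hf => ?_) (fun f _ f' _ hff => ?_) (Set.toFinite _)
    · exact ⟨hT f hf, by simpa [hF] using hB f hf, by simpa [hF] using hX f hf⟩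
    · simp only [Prod.mk.injEq] at hff
      rw [← switching_switching (B f) (X f) f, hff.1, hff.2.1, hff.2.2, switching_switching]
  rwa [Set.ncard_prod, Set.ncard_prod, Set.ncard_coe_finset, ← sq] at h1

theorem degOf_eq_succ {m : ℕ →₀ ℕ} {i j : ℕ} (h1 : ∑ k ∈ Finset.Icc 1 j, m k ≤ i)
    (h2 : i < ∑ k ∈ Finset.Icc 1 (j + 1), m k) : degOf m i = j + 1 := by
  refine le_antisymm (Nat.sInf_le h2) ?_
  have hmem : i < ∑ k ∈ Finset.Icc 1 (degOf m i), m k :=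
    Nat.sInf_mem (s := {j : ℕ | i < ∑ k ∈ Finset.Icc 1 j, m k}) ⟨_, h2⟩
  by_contra hlt
  have := Finset.sum_le_sum_of_subset (f := m)
    (Finset.Icc_subset_Icc_right (a := 1) (show degOf m i ≤ j by omega))
  omega

theorem sum_range_degOf (m : ℕ →₀ ℕ) (J : ℕ) :
    ∑ i ∈ Finset.range (∑ k ∈ Finset.Icc 1 J, m k), degOf m i
      = ∑ k ∈ Finset.Icc 1 J, k * m k := by
  induction J with
  | zero => simp
  | succ J ih =>
    have hS : ∑ k ∈ Finset.Icc 1 (J + 1), m k = ∑ k ∈ Finset.Icc 1 J, m k + m (J + 1) :=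
      Finset.sum_Icc_succ_top (by omega) _
    rw [hS, Finset.sum_range_add, ih, Finset.sum_Icc_succ_top (by omega)]
    congr 1
    rw [Finset.sum_congr rfl fun x hx => degOf_eq_succ (Nat.le_add_right _ x)
      (by rw [hS]; have := Finset.mem_range.1 hx; omega)]
    simp [mul_comm]

theorem exists_Icc_support {m : ℕ →₀ ℕ} (h0 : m 0 = 0) :
    ∃ J, m.support ⊆ Finset.Icc 1 J := by
  refine ⟨m.support.sup id, fun i hi => Finset.mem_Icc.2 ⟨?_, Finset.le_sup (f := id) hi⟩⟩
  rcases Nat.eq_zero_or_pos i with rfl | h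
  · exact absurd h0 (Finsupp.mem_support_iff.1 hi)
  · exact h

theorem numV_eq_sum_Icc {m : ℕ →₀ ℕ} {J : ℕ} (hJ : m.support ⊆ Finset.Icc 1 J) :
    numV m = ∑ k ∈ Finset.Icc 1 J, m k :=
  Finsupp.sum_of_support_subset _ hJ _ (by simp)

theorem sum_degOf {m : ℕ →₀ ℕ} (h0 : m 0 = 0) :
    ∑ v : Fin (numV m), degOf m (v : ℕ) = totalDeg m := by
  obtain ⟨J, hJ⟩ := exists_Icc_support h0
  rw [Fin.sum_univ_eq_sum_range (fun i => degOf m i), numV_eq_sum_Icc hJ, sum_range_degOf]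
  exact (Finsupp.sum_of_support_subset _ hJ _ (by simp)).symm

theorem degOf_pos {m : ℕ →₀ ℕ} (h0 : m 0 = 0) {i : ℕ} (hi : i < numV m) : 0 < degOf m i := by
  obtain ⟨J, hJ⟩ := exists_Icc_support h0
  rw [numV_eq_sum_Icc hJ] at hi
  have hmem : i < ∑ k ∈ Finset.Icc 1 (degOf m i), m k :=
    Nat.sInf_mem (s := {j : ℕ | i < ∑ k ∈ Finset.Icc 1 j, m k}) ⟨_, hi⟩
  by_contra h
  simp [Nat.eq_zero_of_not_pos h] at hmem

theorem adj_eq_hAdj (m : ℕ →₀ ℕ) (f : HalfEdges m → HalfEdges m) :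
    adj m f = HAdj Sigma.fst f := by
  funext u v
  apply propext
  constructor
  · rintro ⟨j, j', h⟩
    exact ⟨⟨u, j⟩, rfl, by rw [h]⟩
  · rintro ⟨⟨u, j⟩, rfl, rfl⟩
    exact ⟨j, (f ⟨u, j⟩).2, rfl⟩

theorem card_halfEdges {m : ℕ →₀ ℕ} (h0 : m 0 = 0) :
    Fintype.card (HalfEdges m) = totalDeg m := by
  simp [Fintype.card_sigma, sum_degOf h0]

open Classical in
/-- The total degree of the type of a component is its number of half-edges. -/
theorem totalDeg_eq_card_of_compType {m m' : ℕ →₀ ℕ} {f : HalfEdges m → HalfEdges m}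
    {v : Fin (numV m)} (h : ∀ i, compType m f v i = m' i) :
    totalDeg m' = (Finset.univ.filter fun x : HalfEdges m => x.1 ∈ component m f v).card := by
  have hc : ∀ i, m' i = ((Finset.univ.filter fun u : Fin (numV m) =>
      u ∈ component m f v).filter fun u : Fin (numV m) => degOf m (u : ℕ) = i).card := by
    intro i
    rw [← h i, compType, ← Set.ncard_coe_finset]
    congr 1
    ext u
    simp
  have h1 : (Finset.univ.filter fun x : HalfEdges m => x.1 ∈ component m f v).card
      = ∑ u ∈ Finset.univ.filter (fun u : Fin (numV m) => u ∈ component m f v),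
        degOf m (u : ℕ) := by
    rw [Finset.card_filter, Fintype.sum_sigma, Finset.sum_filter]
    refine Finset.sum_congr rfl fun u _ => ?_
    by_cases hu : u ∈ component m f v <;> simp [hu]
  rw [h1, ← Finset.sum_fiberwise_of_maps_to (t := m'.support)
    (g := fun u : Fin (numV m) => degOf m (u : ℕ))]
  · refine Finset.sum_congr rfl fun i _ => ?_
    dsimp only
    rw [Finset.sum_congr rfl fun u hu => (Finset.mem_filter.1 hu).2, hc i]
    simp [mul_comm]
  · intro u hu
    rw [Finsupp.mem_support_iff, hc]
    exact Finset.card_ne_zero_of_mem (Finset.mem_filter.2 ⟨hu, rfl⟩)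

/-- A configuration with a component of almost full total degree can be switched into a
connected one along few half-edges, keeping simplicity. -/
theorem exists_switching_of_neps {m : ℕ →₀ ℕ} (h0 : m 0 = 0) {ε : ℝ} (hε : 0 ≤ ε)
    (hm : 2 * (numV m : ℝ) ≤ (1 - 3 * ε) * totalDeg m) {f : HalfEdges m → HalfEdges m}
    (hf : IsConfig m f) (hc : ∃ m' ∈ Neps ε m, HasCompOfType m f m') :
    ∃ B X : Finset (HalfEdges m), B.card ≤ ⌊ε * totalDeg m⌋₊ ∧ X.card ≤ ⌊ε * totalDeg m⌋₊ ∧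
      IsConfig m (switching B X f) ∧ IsConn m (switching B X f) ∧
      (IsSimple m f → IsSimple m (switching B X f)) := by
  classical
  obtain ⟨m', ⟨-, hm'⟩, v, hv⟩ := hc
  have hdeg := totalDeg_eq_card_of_compType hv
  have hsplit := Finset.card_filter_add_card_filter_not
    (s := (Finset.univ : Finset (HalfEdges m))) (fun x => x.1 ∈ component m f v)
  rw [Finset.card_univ, card_halfEdges h0, ← hdeg] at hsplit
  have hsplit' : (totalDeg m' : ℝ) + ((Finset.univ.filter fun x : HalfEdges m =>
      x.1 ∉ component m f v).card : ℝ) = totalDeg m := by exact_mod_cast hsplit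
  have hpos : 0 ≤ ε * (totalDeg m : ℝ) := by positivity
  have hfl := Nat.floor_le hpos
  have hsurj : Function.Surjective (Sigma.fst : HalfEdges m → Fin (numV m)) :=
    fun u => ⟨⟨u, ⟨0, degOf_pos h0 u.2⟩⟩, rfl⟩
  simp only [component, Set.mem_ofPred_eq, adj_eq_hAdj] at hdeg hsplit'
  obtain ⟨B, X, hB, hX, hconn, hsimple⟩ := exists_connecting_switching hsurj hf.1 hf.2 v
    (out := ⌊ε * totalDeg m⌋₊) (Nat.le_floor (by linarith)) (by
      rw [← hdeg, Fintype.card_fin]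
      have : 2 * (numV m : ℝ) + 2 * (⌊ε * totalDeg m⌋₊ : ℝ) ≤ totalDeg m' := by linarith
      exact_mod_cast this)
  refine ⟨B, X, hB, hX, ⟨switching_involutive B X hf.1, switching_ne B X hf.2⟩, ?_, hsimple⟩
  rw [IsConn, adj_eq_hAdj]
  exact hconn

theorem card_finset_card_le_le_exp (H : Type*) [Fintype H] {ε t : ℝ} (hε : 0 ≤ ε)
    (ht : 0 < t) (ht1 : t ≤ 1) :
    ((Finset.univ.filter fun S : Finset H => S.card ≤ ⌊ε * Fintype.card H⌋₊).card : ℝ)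
      ≤ Real.exp (Fintype.card H * (t + ε * -Real.log t)) := by
  set k := ⌊ε * (Fintype.card H : ℝ)⌋₊ with hk
  have hk' : (k : ℝ) ≤ ε * Fintype.card H := Nat.floor_le (by positivity)
  have h1 := card_finset_card_le_mul_pow_le H k ht ht1
  have hlog : 0 ≤ -Real.log t := neg_nonneg.2 (Real.log_nonpos ht.le ht1)
  have h2 : (1 + t) ^ Fintype.card H ≤ Real.exp (Fintype.card H * t) := by
    rw [Real.exp_nat_mul]
    exact pow_le_pow_left₀ (by positivity) (by linarith [Real.add_one_le_exp t]) _
  have h3 : t ^ k = Real.exp (-(k * -Real.log t)) := by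
    rw [mul_neg, neg_neg, Real.exp_nat_mul, Real.exp_log ht]
  rw [h3, Real.exp_neg, ← div_eq_mul_inv, div_le_iff₀ (Real.exp_pos _)] at h1
  refine h1.trans ((mul_le_mul_of_nonneg_right h2 (Real.exp_pos _).le).trans ?_)
  rw [← Real.exp_add]
  apply Real.exp_le_exp.2
  have := mul_le_mul_of_nonneg_right hk' hlog
  linarith

theorem log_div_le_of_le_mul_sq {a c M : ℕ} {D : ℝ} (hD : 0 ≤ D) (h : a ≤ c * M ^ 2)
    (hM : (M : ℝ) ≤ Real.exp D) : Real.log ((a : ℝ) / c) ≤ 2 * D := by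
  rcases Nat.eq_zero_or_pos a with rfl | ha
  · simpa using hD
  rcases Nat.eq_zero_or_pos c with rfl | hc
  · simpa using hD
  have ha' : (0 : ℝ) < a := by exact_mod_cast ha
  have hc' : (0 : ℝ) < c := by exact_mod_cast hc
  rw [Real.log_le_iff_le_exp (by positivity), div_le_iff₀ hc', two_mul, Real.exp_add]
  calc (a : ℝ) ≤ c * (M : ℝ) ^ 2 := by exact_mod_cast h
    _ = M * M * c := by ring
    _ ≤ _ := by gcongr

theorem limsup_le_of_eventually_le_of_nonneg {u : ℕ → ℝ} {η : ℝ} (hη : 0 ≤ η)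
    (h : ∀ᶠ n in Filter.atTop, u n ≤ η) : Filter.limsup u Filter.atTop ≤ η := by
  rw [Filter.limsup_eq]
  by_cases hb : BddBelow {a | ∀ᶠ n in Filter.atTop, u n ≤ a}
  · exact csInf_le hb h
  · rwa [Real.sInf_of_not_bddBelow hb]

theorem typeOf_zero {d : (n : ℕ) → Fin n → ℕ} (hd : ∀ n j, 0 < d n j) (n : ℕ) :
    typeOf d n 0 = 0 := by
  simp [typeOf, Finsupp.finsetSum_apply, (hd n _).ne']

theorem numV_typeOf (d : (n : ℕ) → Fin n → ℕ) (n : ℕ) : numV (typeOf d n) = n := by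
  rw [numV, typeOf, ← Finsupp.sum_finsetSum_index (by simp) (by simp)]
  simp

theorem totalDeg_typeOf (d : (n : ℕ) → Fin n → ℕ) (n : ℕ) :
    totalDeg (typeOf d n) = ℓTot d n := by
  rw [totalDeg, typeOf, ← Finsupp.sum_finsetSum_index (by simp) (by simp [mul_add])]
  simp [ℓTot]

/-- Proposition 4.4 of the paper: many graphs with a very large
component are connected: `|𝒞_{n(n)}^{𝒩^ε}| = e^{δ(ε)n}·|𝒞c_{n(n)}|` and
`|𝒮_{n(n)}^{𝒩^ε}| = e^{δ(ε)n}·|𝒮c_{n(n)}|` with `δ(ε) → 0` as `ε ↓ 0`. -/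
theorem almost_connected_switchings
    (d : (n : ℕ) → Fin n → ℕ) (p : ℕ → ℝ)
    (hdpos : ∀ n j, 0 < d n j) (hdeven : ∀ n, Even (ℓTot d n))
    (hp0 : p 0 = 0) (hpnn : ∀ i, 0 ≤ p i) (hpsum : ∑' i : ℕ, p i = 1)
    (ha : ∀ i : ℕ, Filter.Tendsto (fun n : ℕ => (typeOf d n i : ℝ) / (n : ℝ))
      Filter.atTop (nhds (p i)))
    (hmom : Summable fun i : ℕ => (i : ℝ) * p i)
    (hb : Filter.Tendsto (fun n : ℕ => (ℓTot d n : ℝ) / (n : ℝ)) Filter.atTop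
      (nhds (∑' i : ℕ, (i : ℝ) * p i)))
    (hμ : 2 < ∑' i : ℕ, (i : ℝ) * p i) :
    ∃ ε' : ℝ, 0 < ε' ∧ ∀ η : ℝ, 0 < η → ∃ ε'' : ℝ, (0 < ε'' ∧ ε'' ≤ ε') ∧
      ∀ ε : ℝ, 0 < ε → ε < ε'' →
        Filter.limsup (fun n : ℕ =>
            (1 / (n : ℝ)) * Real.log
              ((cCcompSet (typeOf d n) (Neps ε (typeOf d n)) : ℝ)
                / (cCc (typeOf d n) : ℝ))) Filter.atTop ≤ η
        ∧ Filter.limsup (fun n : ℕ =>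
            (1 / (n : ℝ)) * Real.log
              ((cScompSet (typeOf d n) (Neps ε (typeOf d n)) : ℝ)
                / (cSc (typeOf d n) : ℝ))) Filter.atTop ≤ η := by
  set μ := ∑' i : ℕ, (i : ℝ) * p i with hμdef
  have hμ0 : 0 < μ := by linarith
  have hε'pos : 0 < (1 - 2 / μ) / 6 := by
    have : 2 / μ < 1 := (div_lt_one hμ0).2 hμ
    linarith
  have hε'μ : 2 < (1 - 3 * ((1 - 2 / μ) / 6)) * μ := by
    have : (1 - 3 * ((1 - 2 / μ) / 6)) * μ = μ / 2 + 1 := by field_simp; ring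
    linarith
  refine ⟨(1 - 2 / μ) / 6, hε'pos, fun η hη => ?_⟩
  set ε' := (1 - 2 / μ) / 6
  set t := min 1 (η / (4 * (μ + 1))) with ht
  have ht0 : 0 < t := lt_min one_pos (by positivity)
  have ht1 : t ≤ 1 := min_le_left _ _
  have htη : t ≤ η / (4 * (μ + 1)) := min_le_right _ _
  have hL : 0 ≤ -Real.log t := neg_nonneg.2 (Real.log_nonpos ht0.le ht1)
  set L := -Real.log t
  refine ⟨min ε' (η / (4 * (μ + 1)) / (L + 1)), ⟨lt_min hε'pos (by positivity), min_le_left _ _⟩,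
    fun ε hε hεlt => ?_⟩
  have hεε' : ε ≤ ε' := hεlt.le.trans (min_le_left _ _)
  have hεL : ε * L ≤ η / (4 * (μ + 1)) := by
    have h1 : ε * (L + 1) ≤ η / (4 * (μ + 1)) :=
      (le_div_iff₀ (by positivity)).1 (hεlt.le.trans (min_le_right _ _))
    nlinarith
  have hlow : ∀ᶠ n : ℕ in Filter.atTop,
      2 < (1 - 3 * ε') * ((ℓTot d n : ℝ) / n) := (hb.const_mul _).eventually_const_lt hε'μ
  have hup : ∀ᶠ n : ℕ in Filter.atTop, (ℓTot d n : ℝ) / n < μ + 1 :=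
    hb.eventually_lt_const (by linarith)
  have key : ∀ᶠ n : ℕ in Filter.atTop, ∀ a c : ℕ,
      ((2 * (numV (typeOf d n) : ℝ) ≤ (1 - 3 * ε) * totalDeg (typeOf d n)) →
        a ≤ c * (Finset.univ.filter fun S : Finset (HalfEdges (typeOf d n)) =>
          S.card ≤ ⌊ε * totalDeg (typeOf d n)⌋₊).card ^ 2) →
      1 / (n : ℝ) * Real.log ((a : ℝ) / c) ≤ η := by
    filter_upwards [hlow, hup, Filter.eventually_gt_atTop 0] with n hn1 hn2 hn0 a c hac
    have hn : (0 : ℝ) < n := by exact_mod_cast hn0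
    have hexp := card_finset_card_le_le_exp (HalfEdges (typeOf d n)) hε.le ht0 ht1
    rw [card_halfEdges (typeOf_zero hdpos n)] at hexp
    have hV : (numV (typeOf d n) : ℝ) = n := by rw [numV_typeOf]
    rw [totalDeg_typeOf] at hac hexp
    have hℓ : (0 : ℝ) ≤ ℓTot d n := by positivity
    have hlog := log_div_le_of_le_mul_sq (D := ℓTot d n * (t + ε * L)) (by positivity)
      (hac (by
        rw [← mul_div_assoc, lt_div_iff₀ hn] at hn1
        rw [hV]
        nlinarith)) hexp
    have hsum : t + ε * L ≤ η / (2 * (μ + 1)) := by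
      have : η / (2 * (μ + 1)) = η / (4 * (μ + 1)) + η / (4 * (μ + 1)) := by
        field_simp; norm_num
      linarith
    calc 1 / (n : ℝ) * Real.log ((a : ℝ) / c)
        ≤ 1 / (n : ℝ) * (2 * (ℓTot d n * (t + ε * L))) := by gcongr
      _ = 2 * ((ℓTot d n : ℝ) / n * (t + ε * L)) := by ring
      _ ≤ 2 * ((μ + 1) * (η / (2 * (μ + 1)))) := by gcongr
      _ = η := by field_simp
  constructor
  · refine limsup_le_of_eventually_le_of_nonneg hη.le (key.mono fun n hn => hn _ _ fun hm => ?_)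
    refine ncard_le_of_switching _ _ _ fun f hf => ?_
    obtain ⟨B, X, hB, hX, h1, h2, -⟩ :=
      exists_switching_of_neps (typeOf_zero hdpos n) hε.le hm hf.1 hf.2
    exact ⟨B, X, hB, hX, h1, h2⟩
  · refine limsup_le_of_eventually_le_of_nonneg hη.le (key.mono fun n hn => hn _ _ fun hm => ?_)
    refine ncard_le_of_switching _ _ _ fun f hf => ?_
    obtain ⟨B, X, hB, hX, h1, h2, h3⟩ :=
      exists_switching_of_neps (typeOf_zero hdpos n) hε.le hm hf.1 hf.2.2
    exact ⟨B, X, hB, hX, h1, h3 hf.2.1, h2⟩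

end PaperCM
end

section
/- Let p satisfy Condition P (p_1 > 0 and 2 < μ_p := Σ_k k·p_k < ∞). Then p is a continuity point of the map p ↦ K(p) with respect to the metric d(p,q) = Σ_{k≥1} k·|p_k − q_k| on probability distributions on the positive integers with q_1 > 0 and Σ_k k·q_k > 2. Moreover, for every η ∈ (0, 1/2) there exists a constant C(η) < ∞ such that |K(p) − K(q)| ≤ C(η)·d(p,q) for all probability distributions p, q on the positive integers with p_1 > 0, q_1 > 0, Σ_k k·p_k ≥ 2/(1−2η) and Σ_k k·q_k ≥ 2/(1−2η) (both finite). -/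
namespace PaperCM

/-- Condition P together with `p` being a probability distribution on the positive integers. -/
structure ConditionP (p : ℕ → ℝ) : Prop where
  zero : p 0 = 0
  nonneg : ∀ i, 0 ≤ p i
  tsum_eq_one : ∑' i : ℕ, p i = 1
  one_pos : 0 < p 1
  summable_mul : Summable fun k : ℕ => (k : ℝ) * p k
  two_lt_mean : 2 < ∑' k : ℕ, (k : ℝ) * p k

/-- `-k * slope k` is the derivative of `kernel k` with respect to `artanh b`. -/
noncomputable def slope (k : ℕ) (b : ℝ) : ℝ := (b ^ 2 - b ^ k) / (b * (1 - b ^ k))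

/-- The coefficient of `p k` in `Kof p`, as a function of `b = betaOf p`. -/
noncomputable def kernel (k : ℕ) (b : ℝ) : ℝ :=
  (k : ℝ) / 2 * Real.log (1 - b ^ 2) - Real.log (1 - b ^ k)

lemma one_sub_le_one_sub_pow {b : ℝ} (h0 : 0 < b) (h1 : b < 1) {k : ℕ} (hk : k ≠ 0) :
    1 - b ≤ 1 - b ^ k := by
  have := pow_le_of_le_one h0.le h1.le hk
  linarith

lemma slope_lt_one {b : ℝ} (h0 : 0 < b) (h1 : b < 1) {k : ℕ} (hk : k ≠ 0) : slope k b < 1 := by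
  have h := one_sub_le_one_sub_pow h0 h1 hk
  have hp : 0 < b ^ k := by positivity
  rw [slope, div_lt_one (mul_pos h0 (by linarith))]
  nlinarith [mul_pos (sub_pos.2 h1) (add_pos h0 hp)]

lemma neg_one_le_slope {b : ℝ} (h0 : 0 < b) (h1 : b < 1) {k : ℕ} (hk : k ≠ 0) :
    -1 ≤ slope k b := by
  have h := one_sub_le_one_sub_pow h0 h1 hk
  rw [slope, le_div_iff₀ (mul_pos h0 (by linarith))]
  nlinarith [mul_nonneg (by linarith : 0 ≤ 1 + b) (by linarith : 0 ≤ b - b ^ k)]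

lemma abs_mul_slope_le {b : ℝ} (h0 : 0 < b) (h1 : b < 1) (k : ℕ) :
    |(k : ℝ) * slope k b| ≤ k := by
  rcases eq_or_ne k 0 with rfl | hk
  · simp
  · rw [abs_mul, Nat.abs_cast]
    exact mul_le_of_le_one_right (by positivity)
      (abs_le.2 ⟨neg_one_le_slope h0 h1 hk, (slope_lt_one h0 h1 hk).le⟩)

lemma slope_one {b : ℝ} (h0 : 0 < b) (h1 : b < 1) : slope 1 b = -1 := by
  have : 1 - b ≠ 0 := by linarith
  rw [slope]
  field_simp
  ring

lemma slope_two (b : ℝ) : slope 2 b = 0 := by simp [slope]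

lemma slope_add_two {b : ℝ} (h0 : 0 < b) (h1 : b < 1) {k : ℕ} (hk : k ≠ 0) :
    slope (k + 2) b = 1 / (b + 1 / b - slope k b) := by
  have h := one_sub_le_one_sub_pow h0 h1 hk
  have h' := one_sub_le_one_sub_pow h0 h1 (show k + 2 ≠ 0 by omega)
  have hk0 : 1 - b ^ k ≠ 0 := by linarith
  have hk2 : 1 - b ^ (k + 2) ≠ 0 := by linarith
  have key : b + 1 / b - slope k b = (1 - b ^ (k + 2)) / (b * (1 - b ^ k)) := by
    rw [slope]
    field_simp
    ring
  rw [key, slope, one_div_div]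
  field_simp
  ring

lemma slope_add_two_lt {b c : ℝ} (h0 : 0 < b) (hbc : b < c) (h1 : c < 1) {k : ℕ} (hk : k ≠ 0)
    (h : slope k b ≤ slope k c) : slope (k + 2) b < slope (k + 2) c := by
  have hc0 := h0.trans hbc
  rw [slope_add_two h0 (hbc.trans h1) hk, slope_add_two hc0 h1 hk]
  have hlt := slope_lt_one hc0 h1 hk
  have hinv : 1 < 1 / c := (one_lt_div hc0).2 h1
  have hsum : c + 1 / c < b + 1 / b := by
    have : b + 1 / b - (c + 1 / c) = (c - b) * (1 - b * c) / (b * c) := by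
      field_simp
      ring
    have : 0 < (c - b) * (1 - b * c) / (b * c) :=
      div_pos (mul_pos (by linarith) (by nlinarith)) (by positivity)
    linarith
  exact one_div_lt_one_div_of_lt (by linarith) (by linarith)

lemma slope_mono {b c : ℝ} (h0 : 0 < b) (hbc : b < c) (h1 : c < 1) :
    ∀ k : ℕ, k ≠ 0 → slope k b ≤ slope k c
  | 0, h => absurd rfl h
  | 1, _ => by rw [slope_one h0 (hbc.trans h1), slope_one (h0.trans hbc) h1]
  | 2, _ => by simp [slope_two]
  | k + 3, _ =>
    (slope_add_two_lt h0 hbc h1 k.succ_ne_zero (slope_mono h0 hbc h1 (k + 1) k.succ_ne_zero)).le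

lemma slope_strictMono {b c : ℝ} (h0 : 0 < b) (hbc : b < c) (h1 : c < 1) {k : ℕ} (hk : 3 ≤ k) :
    slope k b < slope k c := by
  obtain ⟨m, rfl⟩ := Nat.exists_eq_add_of_le' hk
  exact slope_add_two_lt h0 hbc h1 m.succ_ne_zero (slope_mono h0 hbc h1 _ m.succ_ne_zero)

lemma slope_le_self {b : ℝ} (h0 : 0 < b) (h1 : b < 1) {k : ℕ} (hk : 2 ≤ k) :
    slope k b ≤ b := by
  have h := one_sub_le_one_sub_pow h0 h1 (show k ≠ 0 by omega)
  have hp : 0 < b ^ k := by positivity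
  rw [slope, div_le_iff₀ (mul_pos h0 (by linarith))]
  nlinarith [mul_pos hp (sub_pos.2 (show b ^ 2 < 1 by nlinarith))]

lemma one_sub_sq_div_eq {b : ℝ} (h0 : 0 < b) (h1 : b < 1) {k : ℕ} (hk : k ≠ 0) :
    (1 - b ^ 2) / (1 - b ^ k) = 1 - b * slope k b := by
  have h := one_sub_le_one_sub_pow h0 h1 hk
  have : 1 - b ^ k ≠ 0 := by linarith
  rw [slope]
  field_simp
  ring

/-- With `ε = 1 - b`, this follows from `b ^ k ≤ 1 / (1 + k ε)`. -/
lemma mul_one_sub_mul_slope_le {b : ℝ} (h0 : 0 < b) (h1 : b < 1) {k : ℕ} (hk : k ≠ 0) :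
    (k : ℝ) * (1 - b * slope k b) ≤ (1 + b) * (1 + k * (1 - b)) := by
  have h := one_sub_le_one_sub_pow h0 h1 hk
  have hpos : 0 < 1 - b ^ k := by linarith
  have bern : 1 + (k : ℝ) * (1 / b - 1) ≤ (1 / b) ^ k := by
    have := one_add_mul_le_pow (a := 1 / b - 1) (by have := one_div_pos.2 h0; linarith) k
    simpa using this
  have hb : 1 - b ≤ 1 / b - 1 := by
    have : 1 / b - 1 - (1 - b) = (1 - b) ^ 2 / b := by
      field_simp
    have : 0 ≤ (1 - b) ^ 2 / b := by positivity
    linarith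
  have hk' : (0 : ℝ) ≤ k := by positivity
  have hle : 1 + (k : ℝ) * (1 - b) ≤ (1 / b) ^ k :=
    le_trans (by nlinarith) bern
  have hpow : b ^ k * (1 + k * (1 - b)) ≤ 1 := by
    calc b ^ k * (1 + k * (1 - b)) ≤ b ^ k * (1 / b) ^ k := by gcongr
      _ = 1 := by rw [← mul_pow, mul_one_div_cancel h0.ne', one_pow]
  rw [← one_sub_sq_div_eq h0 h1 hk, mul_div_assoc', div_le_iff₀ hpos]
  nlinarith [mul_nonneg (show (0 : ℝ) ≤ 1 + b by linarith)
    (show (0 : ℝ) ≤ 1 - b ^ k * (1 + k * (1 - b)) by linarith)]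

lemma hasDerivAt_kernel {x : ℝ} (h0 : 0 < x) (h1 : x < 1) {k : ℕ} (hk : k ≠ 0) :
    HasDerivAt (kernel k) (-(k * slope k x / (1 - x ^ 2))) x := by
  have hp : 1 - x ^ k ≠ 0 := by
    have := one_sub_le_one_sub_pow h0 h1 hk
    linarith
  have h2 : 1 - x ^ 2 ≠ 0 := by nlinarith
  have d2 := (((hasDerivAt_pow 2 x).const_sub 1).log h2).const_mul ((k : ℝ) / 2)
  have dk := ((hasDerivAt_pow k x).const_sub 1).log hp
  refine (d2.sub dk).congr_deriv ?_
  obtain ⟨m, rfl⟩ := Nat.exists_eq_succ_of_ne_zero hk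
  simp only [slope, Nat.succ_eq_add_one, Nat.add_sub_cancel] at *
  push_cast
  field_simp
  ring

lemma hasDerivAt_log_sub_log {x : ℝ} (h0 : 0 < x) (h1 : x < 1) :
    HasDerivAt (fun x : ℝ => (Real.log (1 + x) - Real.log (1 - x)) / 2) (1 / (1 - x ^ 2)) x := by
  have ha : 1 + x ≠ 0 := by linarith
  have hb : 1 - x ≠ 0 := by linarith
  have h2 : 1 - x ^ 2 ≠ 0 := by nlinarith
  have da := ((hasDerivAt_id x).const_add 1).log ha
  have db := ((hasDerivAt_id x).const_sub 1).log hb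
  refine ((da.sub db).div_const 2).congr_deriv ?_
  simp only [id]
  field_simp
  ring

/-- `kernel k` is a concave function of `artanh b`, hence lies below its tangents. -/
lemma kernel_le_tangent {b c : ℝ} (hb0 : 0 < b) (hb1 : b < 1) (hc0 : 0 < c) (hc1 : c < 1) (k : ℕ) :
    kernel k b ≤ kernel k c - k * slope k c *
      ((Real.log (1 + b) - Real.log (1 - b)) / 2 - (Real.log (1 + c) - Real.log (1 - c)) / 2) := by
  rcases eq_or_ne k 0 with rfl | hk
  · simp [kernel]
  set f : ℝ → ℝ := fun x =>
    kernel k x + k * slope k c * ((Real.log (1 + x) - Real.log (1 - x)) / 2) with hf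
  have df : ∀ x, 0 < x → x < 1 → HasDerivAt f (k * (slope k c - slope k x) / (1 - x ^ 2)) x := by
    intro x h0 h1
    refine ((hasDerivAt_kernel h0 h1 hk).add
      ((hasDerivAt_log_sub_log h0 h1).const_mul ((k : ℝ) * slope k c))).congr_deriv ?_
    ring
  suffices f b ≤ f c by
    simp only [hf] at this
    linarith
  rcases lt_trichotomy b c with h | rfl | h
  · refine monotoneOn_of_deriv_nonneg (convex_Icc b c) (fun x hx => ?_) (fun x hx => ?_)
      (fun x hx => ?_) (Set.left_mem_Icc.2 h.le) (Set.right_mem_Icc.2 h.le) h.le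
    · exact (df x (hb0.trans_le hx.1) (hx.2.trans_lt hc1)).continuousAt.continuousWithinAt
    all_goals
      rw [interior_Icc] at hx
      have hx0 := hb0.trans hx.1
      have hx1 := hx.2.trans hc1
    · exact (df x hx0 hx1).differentiableAt.differentiableWithinAt
    · rw [(df x hx0 hx1).deriv]
      have := slope_mono hx0 hx.2 hc1 k hk
      exact div_nonneg (mul_nonneg (by positivity) (by linarith)) (by nlinarith)
  · exact le_rfl
  · refine antitoneOn_of_deriv_nonpos (convex_Icc c b) (fun x hx => ?_) (fun x hx => ?_)
      (fun x hx => ?_) (Set.left_mem_Icc.2 h.le) (Set.right_mem_Icc.2 h.le) h.le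
    · exact (df x (hc0.trans_le hx.1) (hx.2.trans_lt hb1)).continuousAt.continuousWithinAt
    all_goals
      rw [interior_Icc] at hx
      have hx0 := hc0.trans hx.1
      have hx1 := hx.2.trans hb1
    · exact (df x hx0 hx1).differentiableAt.differentiableWithinAt
    · rw [(df x hx0 hx1).deriv]
      have := slope_mono hc0 hx.1 hx1 k hk
      exact div_nonpos_of_nonpos_of_nonneg
        (mul_nonpos_of_nonneg_of_nonpos (by positivity) (by linarith)) (by nlinarith)

lemma abs_log_one_sub_pow_le {b η : ℝ} (h0 : 0 < b) (hη : 0 < η) (hb : b ≤ 1 - η) {k : ℕ}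
    (hk : k ≠ 0) : |Real.log (1 - b ^ k)| ≤ -Real.log η := by
  have h := one_sub_le_one_sub_pow h0 (by linarith) hk
  have hp : 0 < b ^ k := by positivity
  rw [abs_of_nonpos (Real.log_nonpos (by linarith) (by linarith))]
  exact neg_le_neg (Real.log_le_log hη (by linarith))

lemma abs_kernel_le {b η : ℝ} (h0 : 0 < b) (hη : 0 < η) (hb : b ≤ 1 - η) (k : ℕ) :
    |kernel k b| ≤ -(3 / 2) * Real.log η * k := by
  rcases eq_or_ne k 0 with rfl | hk
  · simp [kernel]
  have hlog : 0 ≤ -Real.log η := neg_nonneg.2 (Real.log_nonpos hη.le (by linarith))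
  have hk1 : (1 : ℝ) ≤ k := by exact_mod_cast Nat.one_le_iff_ne_zero.2 hk
  calc |kernel k b| ≤ |(k : ℝ) / 2 * Real.log (1 - b ^ 2)| + |Real.log (1 - b ^ k)| := abs_sub _ _
    _ = (k : ℝ) / 2 * |Real.log (1 - b ^ 2)| + |Real.log (1 - b ^ k)| := by
      rw [abs_mul, abs_of_nonneg (by positivity : (0 : ℝ) ≤ k / 2)]
    _ ≤ (k : ℝ) / 2 * (-Real.log η) + -Real.log η := by
      gcongr
      · exact abs_log_one_sub_pow_le h0 hη hb two_ne_zero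
      · exact abs_log_one_sub_pow_le h0 hη hb hk
    _ ≤ -(3 / 2) * Real.log η * k := by nlinarith

namespace ConditionP

variable {p q : ℕ → ℝ}

lemma summable (hp : ConditionP p) : Summable p := by
  by_contra h
  have := hp.tsum_eq_one
  rw [tsum_eq_zero_of_not_summable h] at this
  exact zero_ne_one this

lemma summable_mul_of_abs_le (hp : ConditionP p) {C : ℝ} {f : ℕ → ℝ}
    (hf : ∀ k : ℕ, |f k| ≤ C * k) : Summable fun k => p k * f k := by
  refine .of_norm_bounded (hp.summable_mul.mul_left C) fun k => ?_
  rw [Real.norm_eq_abs, abs_mul, abs_of_nonneg (hp.nonneg k)]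
  nlinarith [mul_le_mul_of_nonneg_left (hf k) (hp.nonneg k)]

lemma summable_slope (hp : ConditionP p) {b : ℝ} (h0 : 0 < b) (h1 : b < 1) :
    Summable fun k : ℕ => p k * (k * slope k b) :=
  hp.summable_mul_of_abs_le (C := 1) fun k => by simpa using abs_mul_slope_le h0 h1 k

lemma summable_kernel (hp : ConditionP p) {b : ℝ} (h0 : 0 < b) (h1 : b < 1) :
    Summable fun k : ℕ => p k * kernel k b :=
  hp.summable_mul_of_abs_le fun k => abs_kernel_le h0 (sub_pos.2 h1) (by linarith) k

lemma one_sub_sq_mul_tsum (hp : ConditionP p) {b : ℝ} (h0 : 0 < b) (h1 : b < 1) :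
    (1 - b ^ 2) * ∑' k : ℕ, (k : ℝ) * p k / (1 - b ^ k) =
      ∑' k : ℕ, (k : ℝ) * p k - b * ∑' k : ℕ, p k * (k * slope k b) := by
  rw [← tsum_mul_left, ← tsum_mul_left,
    ← hp.summable_mul.tsum_sub ((hp.summable_slope h0 h1).mul_left b)]
  refine tsum_congr fun k => ?_
  rcases eq_or_ne k 0 with rfl | hk
  · simp
  · linear_combination (k : ℝ) * p k * one_sub_sq_div_eq h0 h1 hk

lemma mem_betaOf_iff (hp : ConditionP p) {b : ℝ} (h0 : 0 < b) (h1 : b < 1) :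
    ∑' k : ℕ, (k : ℝ) * p k = (1 - b ^ 2) * ∑' k : ℕ, (k : ℝ) * p k / (1 - b ^ k) ↔
      ∑' k : ℕ, p k * (k * slope k b) = 0 := by
  rw [hp.one_sub_sq_mul_tsum h0 h1]
  constructor
  · intro h
    exact (mul_eq_zero.1 (by linarith : b * _ = 0)).resolve_left h0.ne'
  · intro h
    rw [h]
    ring

/-- A lower bound on the critical sum, which is positive for `b` close to `1`. -/
lemma mean_sub_le_mul_tsum (hp : ConditionP p) {b : ℝ} (h0 : 0 < b) (h1 : b < 1) :
    ∑' k : ℕ, (k : ℝ) * p k - (1 + b) * (1 + (1 - b) * ∑' k : ℕ, (k : ℝ) * p k) ≤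
      b * ∑' k : ℕ, p k * (k * slope k b) := by
  have hs := (hp.summable_slope h0 h1).mul_left b
  have hr : Summable fun k : ℕ => (1 + b) * (p k + (1 - b) * (k * p k)) :=
    (hp.summable.add (hp.summable_mul.mul_left _)).mul_left _
  have key : ∑' k : ℕ, ((k : ℝ) * p k - b * (p k * (k * slope k b))) ≤
      ∑' k : ℕ, (1 + b) * (p k + (1 - b) * (k * p k)) := by
    refine (hp.summable_mul.sub hs).tsum_le_tsum (fun k => ?_) hr
    rcases eq_or_ne k 0 with rfl | hk
    · simp [hp.zero]
    · nlinarith [mul_le_mul_of_nonneg_left (mul_one_sub_mul_slope_le h0 h1 hk) (hp.nonneg k)]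
  rw [hp.summable_mul.tsum_sub hs, tsum_mul_left, tsum_mul_left,
    hp.summable.tsum_add (hp.summable_mul.mul_left _), tsum_mul_left, hp.tsum_eq_one] at key
  linarith

lemma exists_three_le (hp : ConditionP p) : ∃ k, 3 ≤ k ∧ 0 < p k := by
  by_contra! h
  have : ∑' k : ℕ, (k : ℝ) * p k ≤ ∑' k : ℕ, 2 * p k := by
    refine hp.summable_mul.tsum_le_tsum (fun k => ?_) (hp.summable.mul_left 2)
    rcases lt_or_ge k 3 with hk | hk
    · have : (k : ℝ) ≤ 2 := by exact_mod_cast Nat.lt_succ_iff.1 hk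
      exact mul_le_mul_of_nonneg_right this (hp.nonneg k)
    · simp [le_antisymm (h k hk) (hp.nonneg k)]
  rw [tsum_mul_left, hp.tsum_eq_one] at this
  linarith [hp.two_lt_mean]

lemma tsum_slope_strictMono (hp : ConditionP p) {b c : ℝ} (h0 : 0 < b) (hbc : b < c) (h1 : c < 1) :
    ∑' k : ℕ, p k * (k * slope k b) < ∑' k : ℕ, p k * (k * slope k c) := by
  obtain ⟨m, hm, hpm⟩ := hp.exists_three_le
  have hm0 : (0 : ℝ) < m := by exact_mod_cast (by omega : 0 < m)
  refine (hp.summable_slope h0 (hbc.trans h1)).tsum_lt_tsum (i := m) (fun k => ?_) ?_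
    (hp.summable_slope (h0.trans hbc) h1)
  · rcases eq_or_ne k 0 with rfl | hk
    · simp
    · exact mul_le_mul_of_nonneg_left (mul_le_mul_of_nonneg_left (slope_mono h0 hbc h1 k hk)
        (by positivity)) (hp.nonneg k)
  · exact mul_lt_mul_of_pos_left (mul_lt_mul_of_pos_left (slope_strictMono h0 hbc h1 hm) hm0) hpm

lemma continuousOn_tsum_slope (hp : ConditionP p) :
    ContinuousOn (fun b => ∑' k : ℕ, p k * (k * slope k b)) (Set.Ioo 0 1) := by
  refine continuousOn_tsum (fun k => ?_) hp.summable_mul fun k b hb => ?_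
  · rcases eq_or_ne k 0 with rfl | hk
    · simpa using continuousOn_const
    · unfold slope
      refine continuousOn_const.mul (continuousOn_const.mul (ContinuousOn.div (by fun_prop)
        (by fun_prop) fun b hb => ?_))
      have := one_sub_le_one_sub_pow hb.1 hb.2 hk
      exact mul_ne_zero hb.1.ne' (by linarith [hb.2])
  · rw [Real.norm_eq_abs, abs_mul, abs_of_nonneg (hp.nonneg k), mul_comm]
    exact mul_le_mul_of_nonneg_right (abs_mul_slope_le hb.1 hb.2 k) (hp.nonneg k)

lemma tsum_slope_le (hp : ConditionP p) {b : ℝ} (h0 : 0 < b) (h1 : b < 1) :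
    ∑' k : ℕ, p k * (k * slope k b) ≤ b * ∑' k : ℕ, (k : ℝ) * p k - p 1 := by
  have hs : Summable fun k : ℕ => b * ((k : ℝ) * p k) := hp.summable_mul.mul_left b
  have h1s : Summable (Pi.single 1 (p 1) : ℕ → ℝ) := (hasSum_pi_single 1 (p 1)).summable
  have : ∑' k : ℕ, p k * (k * slope k b) ≤
      ∑' k : ℕ, (b * ((k : ℝ) * p k) - (Pi.single 1 (p 1) : ℕ → ℝ) k) := by
    refine (hp.summable_slope h0 h1).tsum_le_tsum (fun k => ?_) (hs.sub h1s)
    rcases lt_or_ge k 2 with hk | hk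
    · interval_cases k
      · simp
      · simp only [slope_one h0 h1, Pi.single_eq_same]
        push_cast
        nlinarith [mul_pos h0 hp.one_pos]
    · rw [Pi.single_eq_of_ne (by omega)]
      have := mul_le_mul_of_nonneg_left (slope_le_self h0 h1 hk)
        (mul_nonneg (Nat.cast_nonneg k) (hp.nonneg k))
      linarith
  rwa [hs.tsum_sub h1s, tsum_mul_left, tsum_pi_single] at this

lemma exists_tsum_slope_eq_zero (hp : ConditionP p) :
    ∃ b ∈ Set.Ioo (0 : ℝ) 1, ∑' k : ℕ, p k * (k * slope k b) = 0 := by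
  set μ := ∑' k : ℕ, (k : ℝ) * p k with hμ
  have hμ2 : 2 < μ := hp.two_lt_mean
  have hμ0 : 0 < μ := by linarith
  obtain ⟨a, ha0, ha⟩ := exists_between (lt_min _root_.one_pos (div_pos hp.one_pos hμ0))
  have ha1 := ha.trans_le (min_le_left _ _)
  have haμ : a * μ < p 1 := (lt_div_iff₀ hμ0).1 (ha.trans_le (min_le_right _ _))
  set ε := (μ - 2) / (2 * μ) with hε
  have hε0 : 0 < ε := div_pos (by linarith) (by linarith)
  have hε1 : ε < 1 := (div_lt_one (by linarith)).2 (by linarith)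
  have hεμ : 2 * (ε * μ) = μ - 2 := by
    rw [hε]
    field_simp
  have hneg := hp.tsum_slope_le ha0 ha1
  have hpos := hp.mean_sub_le_mul_tsum (b := 1 - ε) (by linarith) (by linarith)
  rw [← hμ] at hneg hpos
  have hpos' : 0 < ∑' k : ℕ, p k * (k * slope k (1 - ε)) := by
    refine pos_of_mul_pos_right (lt_of_lt_of_le ?_ hpos) (by linarith : 0 ≤ 1 - ε)
    nlinarith [mul_pos hε0 hμ0, mul_pos hε0 (mul_pos hε0 hμ0)]
  exact isPreconnected_Ioo.intermediate_value ⟨ha0, ha1⟩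
    (⟨by linarith, by linarith⟩ : 1 - ε ∈ Set.Ioo (0 : ℝ) 1) hp.continuousOn_tsum_slope
    ⟨by linarith, hpos'.le⟩

lemma betaOf_spec (hp : ConditionP p) : 0 < betaOf p ∧ betaOf p < 1 ∧
    ∑' k : ℕ, p k * (k * slope k (betaOf p)) = 0 := by
  obtain ⟨b, hb, hbz⟩ := hp.exists_tsum_slope_eq_zero
  have hset : {β : ℝ | β ∈ Set.Ioo 0 1 ∧
      ∑' k : ℕ, (k : ℝ) * p k = (1 - β ^ 2) * ∑' k : ℕ, (k : ℝ) * p k / (1 - β ^ k)} = {b} := by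
    ext c
    simp only [Set.mem_ofPred_eq, Set.mem_singleton_iff]
    constructor
    · rintro ⟨hc, hcz⟩
      rw [hp.mem_betaOf_iff hc.1 hc.2] at hcz
      rcases lt_trichotomy c b with h | h | h
      · linarith [hp.tsum_slope_strictMono hc.1 h hb.2]
      · exact h
      · linarith [hp.tsum_slope_strictMono hb.1 h hc.2]
    · rintro rfl
      exact ⟨hb, (hp.mem_betaOf_iff hb.1 hb.2).2 hbz⟩
  rw [show betaOf p = b by rw [betaOf, hset, csInf_singleton]]
  exact ⟨hb.1, hb.2, hbz⟩

lemma betaOf_le (hp : ConditionP p) {η : ℝ} (hη : 0 < η) (hη2 : η < 1 / 2)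
    (hμ : 2 / (1 - 2 * η) ≤ ∑' k : ℕ, (k : ℝ) * p k) : betaOf p ≤ 1 - η := by
  obtain ⟨h0, h1, hz⟩ := hp.betaOf_spec
  have h := hp.mean_sub_le_mul_tsum h0 h1
  rw [hz, mul_zero] at h
  rw [div_le_iff₀ (by linarith)] at hμ
  have hμ2 := hp.two_lt_mean
  by_contra! hlt
  set μ := ∑' k : ℕ, (k : ℝ) * p k
  nlinarith [mul_pos (sub_pos.2 h1) (show 0 < 1 + (1 - betaOf p) * μ by nlinarith),
    mul_pos (sub_pos.2 hlt) (show 0 < μ by linarith)]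

lemma Kof_eq (hp : ConditionP p) : Kof p = ∑' k : ℕ, p k * kernel k (betaOf p) := by
  obtain ⟨h0, h1, -⟩ := hp.betaOf_spec
  have hl : Summable fun k : ℕ => (k : ℝ) * p k * (Real.log (1 - betaOf p ^ 2) / 2) :=
    hp.summable_mul.mul_right _
  have hr : Summable fun k : ℕ => p k * Real.log (1 - betaOf p ^ k) := by
    refine (hl.sub (hp.summable_kernel h0 h1)).congr fun k => ?_
    rw [kernel]
    ring
  rw [Kof, div_mul_eq_mul_div, mul_div_assoc, ← tsum_mul_right, ← hl.tsum_sub hr]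
  refine tsum_congr fun k => ?_
  rw [kernel]
  ring

/-- `betaOf p` maximizes the function of which `Kof p` is the value at `betaOf p`. -/
lemma tsum_kernel_le_Kof (hp : ConditionP p) {b : ℝ} (h0 : 0 < b) (h1 : b < 1) :
    ∑' k : ℕ, p k * kernel k b ≤ Kof p := by
  obtain ⟨hc0, hc1, hz⟩ := hp.betaOf_spec
  set L := (Real.log (1 + b) - Real.log (1 - b)) / 2 -
    (Real.log (1 + betaOf p) - Real.log (1 - betaOf p)) / 2
  have hs := (hp.summable_slope hc0 hc1).mul_right L
  have hk := hp.summable_kernel hc0 hc1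
  calc ∑' k : ℕ, p k * kernel k b
      ≤ ∑' k : ℕ, (p k * kernel k (betaOf p) - p k * (k * slope k (betaOf p)) * L) := by
        refine (hp.summable_kernel h0 h1).tsum_le_tsum (fun k => ?_) (hk.sub hs)
        have := mul_le_mul_of_nonneg_left (kernel_le_tangent h0 h1 hc0 hc1 k) (hp.nonneg k)
        exact this.trans_eq (by ring)
    _ = Kof p := by rw [hk.tsum_sub hs, tsum_mul_right, hz, zero_mul, sub_zero, hp.Kof_eq]

lemma summable_dist (hp : ConditionP p) (hq : ConditionP q) :
    Summable fun k : ℕ => (k : ℝ) * |p k - q k| := by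
  refine (hp.summable_mul.sub hq.summable_mul).abs.congr fun k => ?_
  rw [← mul_sub, abs_mul, Nat.abs_cast]

lemma Kof_sub_le (hp : ConditionP p) (hq : ConditionP q) {η : ℝ} (hη : 0 < η)
    (hβ : betaOf p ≤ 1 - η) :
    Kof p - Kof q ≤ -(3 / 2) * Real.log η * ∑' k : ℕ, (k : ℝ) * |p k - q k| := by
  obtain ⟨h0, h1, -⟩ := hp.betaOf_spec
  have hkp := hp.summable_kernel h0 h1
  have hkq := hq.summable_kernel h0 h1
  calc Kof p - Kof q
      ≤ ∑' k : ℕ, p k * kernel k (betaOf p) - ∑' k : ℕ, q k * kernel k (betaOf p) := by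
        rw [hp.Kof_eq]
        exact sub_le_sub_left (hq.tsum_kernel_le_Kof h0 h1) _
    _ = ∑' k : ℕ, (p k * kernel k (betaOf p) - q k * kernel k (betaOf p)) :=
        (hkp.tsum_sub hkq).symm
    _ ≤ ∑' k : ℕ, -(3 / 2) * Real.log η * ((k : ℝ) * |p k - q k|) := by
        refine (hkp.sub hkq).tsum_le_tsum (fun k => ?_) ((hp.summable_dist hq).mul_left _)
        rw [← sub_mul]
        refine (le_abs_self _).trans ?_
        rw [abs_mul]
        have := mul_le_mul_of_nonneg_left (abs_kernel_le h0 hη hβ k) (abs_nonneg (p k - q k))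
        linarith
    _ = _ := tsum_mul_left

lemma abs_Kof_sub_le (hp : ConditionP p) (hq : ConditionP q) {η : ℝ} (hη : 0 < η)
    (hη2 : η < 1 / 2) (hμp : 2 / (1 - 2 * η) ≤ ∑' k : ℕ, (k : ℝ) * p k)
    (hμq : 2 / (1 - 2 * η) ≤ ∑' k : ℕ, (k : ℝ) * q k) :
    |Kof p - Kof q| ≤ -(3 / 2) * Real.log η * ∑' k : ℕ, (k : ℝ) * |p k - q k| := by
  refine abs_sub_le_iff.2 ⟨hp.Kof_sub_le hq hη (hp.betaOf_le hη hη2 hμp), ?_⟩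
  simpa only [abs_sub_comm] using hq.Kof_sub_le hp hη (hq.betaOf_le hη hη2 hμq)

lemma mean_sub_mean_le (hp : ConditionP p) (hq : ConditionP q) :
    ∑' k : ℕ, (k : ℝ) * p k - ∑' k : ℕ, (k : ℝ) * q k ≤ ∑' k : ℕ, (k : ℝ) * |p k - q k| := by
  rw [← hp.summable_mul.tsum_sub hq.summable_mul]
  refine (hp.summable_mul.sub hq.summable_mul).tsum_le_tsum (fun k => ?_) (hp.summable_dist hq)
  rw [← mul_sub]
  exact mul_le_mul_of_nonneg_left (le_abs_self _) (Nat.cast_nonneg k)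

end ConditionP

/-- Proposition 3.5 / 6.1 of the paper: `p ↦ K(p)` is continuous at any
`p` satisfying Condition P, with respect to the metric `d(p,q) = Σ_k k·|p_k − q_k|`, and for
every `η ∈ (0,1/2)` it is uniformly Lipschitz on `{p : Σ_k k·p_k ≥ 2/(1−2η)}`. -/
theorem K_continuous_and_Lipschitz
    (p : ℕ → ℝ) (hp0 : p 0 = 0) (hpnn : ∀ i, 0 ≤ p i) (hpsum : ∑' i : ℕ, p i = 1)
    (hp1 : 0 < p 1) (hmom : Summable fun k : ℕ => (k : ℝ) * p k)
    (hμ : 2 < ∑' k : ℕ, (k : ℝ) * p k) :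
    (∀ δ : ℝ, 0 < δ → ∃ r : ℝ, 0 < r ∧ ∀ q : ℕ → ℝ,
      q 0 = 0 → (∀ i, 0 ≤ q i) → (∑' i : ℕ, q i = 1) → 0 < q 1 →
      (Summable fun k : ℕ => (k : ℝ) * q k) → 2 < ∑' k : ℕ, (k : ℝ) * q k →
      (∑' k : ℕ, (k : ℝ) * |p k - q k|) < r → |Kof p - Kof q| < δ)
    ∧ ∀ η : ℝ, 0 < η → η < 1 / 2 → ∃ C : ℝ, ∀ p' q : ℕ → ℝ,
        p' 0 = 0 → (∀ i, 0 ≤ p' i) → (∑' i : ℕ, p' i = 1) → 0 < p' 1 →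
        (Summable fun k : ℕ => (k : ℝ) * p' k) →
        2 / (1 - 2 * η) ≤ ∑' k : ℕ, (k : ℝ) * p' k →
        q 0 = 0 → (∀ i, 0 ≤ q i) → (∑' i : ℕ, q i = 1) → 0 < q 1 →
        (Summable fun k : ℕ => (k : ℝ) * q k) →
        2 / (1 - 2 * η) ≤ ∑' k : ℕ, (k : ℝ) * q k →
        |Kof p' - Kof q| ≤ C * ∑' k : ℕ, (k : ℝ) * |p' k - q k| := by
  refine ⟨fun δ hδ => ?_, fun η hη hη2 => ⟨-(3 / 2) * Real.log η, ?_⟩⟩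
  · have hp : ConditionP p := ⟨hp0, hpnn, hpsum, hp1, hmom, hμ⟩
    set μ := ∑' k : ℕ, (k : ℝ) * p k with hμ_def
    obtain ⟨m, hm2, hmμ⟩ := exists_between hμ
    have hm0 : 0 < m := by linarith
    set η := (m - 2) / (2 * m) with hη_def
    have hη : 0 < η := div_pos (by linarith) (by linarith)
    have hη2 : η < 1 / 2 := by
      rw [hη_def, div_lt_div_iff₀ (by linarith) two_pos]
      linarith
    have hηm : 2 / (1 - 2 * η) = m := by
      rw [hη_def]
      field_simp
      ring
    set C := -(3 / 2) * Real.log η with hC_def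
    have hC : 0 ≤ C := by
      have := Real.log_nonpos hη.le (by linarith)
      linarith
    refine ⟨min (μ - m) (δ / (C + 1)), lt_min (by linarith) (by positivity), ?_⟩
    intro q hq0 hqnn hqsum hq1 hqmom hμq hd
    have hq : ConditionP q := ⟨hq0, hqnn, hqsum, hq1, hqmom, hμq⟩
    have hdm := hd.trans_le (min_le_left _ _)
    have hdδ := (lt_div_iff₀ (by positivity)).1 (hd.trans_le (min_le_right _ _))
    have hmean := hp.mean_sub_mean_le hq
    have hd0 : 0 ≤ ∑' k : ℕ, (k : ℝ) * |p k - q k| := tsum_nonneg fun k => by positivity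
    have hK := hp.abs_Kof_sub_le hq hη hη2 (by rw [hηm]; exact hmμ.le)
      (by rw [hηm]; linarith)
    rw [← hC_def] at hK
    linarith
  · intro p' q hp0' hpnn' hpsum' hp1' hmom' hμ' hq0 hqnn hqsum hq1 hqmom hμq
    have hlt : 2 < 2 / (1 - 2 * η) := by
      rw [lt_div_iff₀ (by linarith)]
      linarith
    exact ConditionP.abs_Kof_sub_le ⟨hp0', hpnn', hpsum', hp1', hmom', hlt.trans_le hμ'⟩
      ⟨hq0, hqnn, hqsum, hq1, hqmom, hlt.trans_le hμq⟩ hη hη2 hμ' hμq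

end PaperCM
end

section
/- Let p = (p_k)_{k≥1} be a probability distribution on the positive integers with p_1 > 0 and 2 < Σ_{k≥1} k·p_k < ∞. Then there exists exactly one β ∈ (0,1) satisfying Σ_{k≥1} k·p_k = (1−β²)·Σ_{k≥1} k·p_k/(1−β^k). -/
open Finset in
/-- The ratio `(1 + x ^ m) / (1 + x + ⋯ + x ^ m)`. -/
noncomputable def endsRatio (m : ℕ) (x : ℝ) : ℝ := (1 + x ^ m) / ∑ i ∈ range (m + 1), x ^ i

open Finset in
theorem one_le_geom_sum_succ {x : ℝ} (hx : 0 ≤ x) (m : ℕ) :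
    1 ≤ ∑ i ∈ range (m + 1), x ^ i := by
  rw [sum_range_succ']
  have : 0 ≤ ∑ i ∈ range m, x ^ (i + 1) := sum_nonneg fun i _ => by positivity
  simpa using this

open Finset in
theorem two_mul_geom_sum_succ (x : ℝ) (m : ℕ) :
    2 * ∑ i ∈ range (m + 1), x ^ i = ∑ i ∈ range (m + 1), (x ^ i + x ^ (m - i)) := by
  have h := sum_range_reflect (fun i => x ^ i) (m + 1)
  simp only [Nat.add_sub_cancel] at h
  rw [sum_add_distrib, h, two_mul]

theorem endsRatio_zero (x : ℝ) : endsRatio 0 x = 2 := by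
  norm_num [endsRatio]

theorem endsRatio_succ_at_zero (m : ℕ) : endsRatio (m + 1) 0 = 1 := by
  simp [endsRatio, Finset.sum_range_succ']

theorem endsRatio_at_one (m : ℕ) : endsRatio m 1 = 2 / (m + 1) := by
  norm_num [endsRatio]

theorem endsRatio_nonneg {x : ℝ} (hx : 0 ≤ x) (m : ℕ) : 0 ≤ endsRatio m x :=
  div_nonneg (by positivity) (zero_le_one.trans (one_le_geom_sum_succ hx m))

theorem endsRatio_le_two {x : ℝ} (hx : x ∈ Set.Icc (0 : ℝ) 1) (m : ℕ) : endsRatio m x ≤ 2 := by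
  have h := one_le_geom_sum_succ hx.1 m
  have h' : x ^ m ≤ 1 := pow_le_one₀ hx.1 hx.2
  rw [endsRatio, div_le_iff₀ (by linarith)]
  linarith

theorem continuousOn_endsRatio (m : ℕ) : ContinuousOn (endsRatio m) (Set.Icc 0 1) := by
  refine ContinuousOn.div (by fun_prop) (by fun_prop) fun x hx => ?_
  linarith [one_le_geom_sum_succ hx.1 m]

theorem ends_mul_pair_identity (a b c d : ℝ) :
    (1 + a * b) * (c + d) - (1 + c * d) * (a + b)
      = (c - a) * (1 - b * d) + (d - b) * (1 - a * c) := by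
  ring

theorem ends_mul_pair_le {x y : ℝ} (hx : 0 ≤ x) (hxy : x ≤ y) (hy : y ≤ 1) {m i : ℕ}
    (hi : i ≤ m) :
    (1 + y ^ m) * (x ^ i + x ^ (m - i)) ≤ (1 + x ^ m) * (y ^ i + y ^ (m - i)) := by
  obtain ⟨j, rfl⟩ := Nat.exists_eq_add_of_le hi
  have hbound (n : ℕ) : x ^ n * y ^ n ≤ 1 :=
    mul_le_one₀ (pow_le_one₀ hx (hxy.trans hy)) (pow_nonneg (hx.trans hxy) n)
      (pow_le_one₀ (hx.trans hxy) hy)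
  have hmono (n : ℕ) : x ^ n ≤ y ^ n := pow_le_pow_left₀ hx hxy n
  have key := ends_mul_pair_identity (x ^ i) (x ^ j) (y ^ i) (y ^ j)
  have h₁ := mul_nonneg (sub_nonneg.2 (hmono i)) (sub_nonneg.2 (hbound j))
  have h₂ := mul_nonneg (sub_nonneg.2 (hmono j)) (sub_nonneg.2 (hbound i))
  rw [Nat.add_sub_cancel_left, pow_add, pow_add]
  linarith

theorem ends_mul_pair_one_lt {x y : ℝ} (hx : 0 ≤ x) (hxy : x < y) (hy : y ≤ 1) (n : ℕ) :
    (1 + y ^ (n + 2)) * (x ^ 1 + x ^ (n + 2 - 1))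
      < (1 + x ^ (n + 2)) * (y ^ 1 + y ^ (n + 2 - 1)) := by
  have hb : x ^ (n + 1) * y ^ (n + 1) < 1 :=
    mul_lt_one_of_nonneg_of_lt_one_left (by positivity)
      (pow_lt_one₀ hx (hxy.trans_le hy) n.succ_ne_zero) (pow_le_one₀ (hx.trans hxy.le) hy)
  have ha : x * y ≤ 1 := mul_le_one₀ (hxy.le.trans hy) (hx.trans hxy.le) hy
  have key := ends_mul_pair_identity x (x ^ (n + 1)) y (y ^ (n + 1))
  have h₁ := mul_pos (sub_pos.2 hxy) (sub_pos.2 hb)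
  have h₂ := mul_nonneg (sub_nonneg.2 (pow_le_pow_left₀ hx hxy.le (n + 1))) (sub_nonneg.2 ha)
  have e (z : ℝ) : z ^ (n + 2) = z * z ^ (n + 1) := by ring
  rw [e, e, pow_one, pow_one, show n + 2 - 1 = n + 1 from rfl]
  linarith

theorem endsRatio_antitoneOn (m : ℕ) : AntitoneOn (endsRatio m) (Set.Icc 0 1) := by
  intro x hx y hy hxy
  have hX := one_le_geom_sum_succ hx.1 m
  have hY := one_le_geom_sum_succ hy.1 m
  rw [endsRatio, endsRatio, div_le_div_iff₀ (by linarith) (by linarith)]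
  refine le_of_mul_le_mul_left ?_ (zero_lt_two' ℝ)
  rw [mul_left_comm, mul_left_comm 2, two_mul_geom_sum_succ, two_mul_geom_sum_succ,
    Finset.mul_sum, Finset.mul_sum]
  exact Finset.sum_le_sum fun i hi =>
    ends_mul_pair_le hx.1 hxy hy.2 (Nat.lt_succ_iff.1 (Finset.mem_range.1 hi))

theorem endsRatio_strictAntiOn (n : ℕ) : StrictAntiOn (endsRatio (n + 2)) (Set.Icc 0 1) := by
  intro x hx y hy hxy
  have hX := one_le_geom_sum_succ hx.1 (n + 2)
  have hY := one_le_geom_sum_succ hy.1 (n + 2)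
  rw [endsRatio, endsRatio, div_lt_div_iff₀ (by linarith) (by linarith)]
  refine lt_of_mul_lt_mul_left ?_ (zero_le_two (α := ℝ))
  rw [mul_left_comm, mul_left_comm 2, two_mul_geom_sum_succ, two_mul_geom_sum_succ,
    Finset.mul_sum, Finset.mul_sum]
  exact Finset.sum_lt_sum
    (fun i hi => ends_mul_pair_le hx.1 hxy.le hy.2 (Nat.lt_succ_iff.1 (Finset.mem_range.1 hi)))
    ⟨1, Finset.mem_range.2 (by omega), ends_mul_pair_one_lt hx.1 hxy hy.2 n⟩

theorem one_sub_sq_div_one_sub_pow {x : ℝ} (hx : x ∈ Set.Ioo (0 : ℝ) 1) (m : ℕ) :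
    (1 - x ^ 2) / (1 - x ^ (m + 1)) = 1 + x * (endsRatio m x - 1) := by
  have hS := one_le_geom_sum_succ hx.1.le m
  have hgeom := geom_sum_mul_neg x (m + 1)
  rw [endsRatio]
  set S := ∑ i ∈ Finset.range (m + 1), x ^ i
  have hS0 : S ≠ 0 := by linarith
  have h1x : 1 - x ≠ 0 := by linarith [hx.2]
  have hm : x * x ^ m = 1 - S * (1 - x) := by rw [hgeom]; ring
  rw [← hgeom, div_eq_iff (mul_ne_zero hS0 h1x)]
  have e : (1 + x * ((1 + x ^ m) / S - 1)) * (S * (1 - x))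
      = (S + (x + x * x ^ m) - x * S) * (1 - x) := by
    field_simp
    ring
  rw [e, hm]
  ring

theorem summable_mul_endsRatio {a : ℕ → ℝ} (ha : ∀ m, 0 ≤ a m) (hsum : Summable a) {x : ℝ}
    (hx : x ∈ Set.Icc (0 : ℝ) 1) : Summable fun m => a m * endsRatio m x :=
  (hsum.mul_right 2).of_nonneg_of_le (fun m => mul_nonneg (ha m) (endsRatio_nonneg hx.1 m))
    fun m => mul_le_mul_of_nonneg_left (endsRatio_le_two hx m) (ha m)

theorem continuousOn_tsum_mul_endsRatio {a : ℕ → ℝ} (ha : ∀ m, 0 ≤ a m) (hsum : Summable a) :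
    ContinuousOn (fun x => ∑' m, a m * endsRatio m x) (Set.Icc 0 1) := by
  refine continuousOn_tsum (fun m => continuousOn_const.mul (continuousOn_endsRatio m))
    (hsum.mul_right 2) fun m x hx => ?_
  rw [Real.norm_of_nonneg (mul_nonneg (ha m) (endsRatio_nonneg hx.1 m))]
  exact mul_le_mul_of_nonneg_left (endsRatio_le_two hx m) (ha m)

theorem strictAntiOn_tsum_mul_endsRatio {a : ℕ → ℝ} (ha : ∀ m, 0 ≤ a m) (hsum : Summable a)
    {n : ℕ} (hn : 0 < a (n + 2)) :
    StrictAntiOn (fun x => ∑' m, a m * endsRatio m x) (Set.Icc 0 1) := fun _ hx _ hy hxy =>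
  Summable.tsum_lt_tsum
    (fun m => mul_le_mul_of_nonneg_left (endsRatio_antitoneOn m hx hy hxy.le) (ha m))
    (mul_lt_mul_of_pos_left (endsRatio_strictAntiOn n hx hy hxy) hn)
    (summable_mul_endsRatio ha hsum hy) (summable_mul_endsRatio ha hsum hx)

theorem tsum_mul_endsRatio_at_zero {a : ℕ → ℝ} (hsum : Summable a) :
    ∑' m, a m * endsRatio m 0 = a 0 + ∑' m, a m := by
  have h : Summable fun m => a m * endsRatio m 0 := by
    refine (summable_nat_add_iff 1).1 ?_
    simpa [endsRatio_succ_at_zero] using (summable_nat_add_iff 1).2 hsum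
  rw [h.tsum_eq_zero_add, hsum.tsum_eq_zero_add]
  simp only [endsRatio_zero, endsRatio_succ_at_zero, mul_one]
  ring

theorem one_sub_sq_mul_tsum {a : ℕ → ℝ} (ha : ∀ m, 0 ≤ a m) (hsum : Summable a) {x : ℝ}
    (hx : x ∈ Set.Ioo (0 : ℝ) 1) :
    (1 - x ^ 2) * ∑' m, a m / (1 - x ^ (m + 1))
      = ∑' m, a m + x * (∑' m, a m * endsRatio m x - ∑' m, a m) := by
  have hF := summable_mul_endsRatio ha hsum (Set.Ioo_subset_Icc_self hx)
  rw [← tsum_mul_left, ← hF.tsum_sub hsum, ← tsum_mul_left,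
    ← hsum.tsum_add ((hF.sub hsum).mul_left x)]
  refine tsum_congr fun m => ?_
  rw [mul_div_left_comm, one_sub_sq_div_one_sub_pow hx]
  ring

/-- existence and uniqueness of `β(p)`: for a probability distribution
`p` on the positive integers with `p 1 > 0` and `2 < Σ_k k·p_k < ∞`, there is exactly one
`β ∈ (0,1)` with `Σ_k k·p_k = (1−β²)·Σ_k k·p_k/(1−β^k)`. -/
theorem beta_exists_unique
    (p : ℕ → ℝ) (hp0 : p 0 = 0) (hpnn : ∀ i, 0 ≤ p i) (hpsum : ∑' i : ℕ, p i = 1)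
    (hp1 : 0 < p 1) (hmom : Summable fun k : ℕ => (k : ℝ) * p k)
    (hμ : 2 < ∑' k : ℕ, (k : ℝ) * p k) :
    ∃! β : ℝ, β ∈ Set.Ioo (0 : ℝ) 1 ∧
      ∑' k : ℕ, (k : ℝ) * p k
        = (1 - β ^ 2) * ∑' k : ℕ, (k : ℝ) * p k / (1 - β ^ k) := by
  have tsum_shift (f : ℕ → ℝ) (hf : f 0 = 0) : ∑' k, f k = ∑' m, f (m + 1) := by
    have h := Function.Injective.tsum_eq (f := f) (add_left_injective 1) fun k hk => by
      rcases k with _ | k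
      · exact absurd hf hk
      · exact ⟨k, rfl⟩
    exact h.symm
  have hps : Summable p := by
    by_contra h
    rw [tsum_eq_zero_of_not_summable h] at hpsum
    exact zero_ne_one hpsum
  set a : ℕ → ℝ := fun m => ((m + 1 : ℕ) : ℝ) * p (m + 1) with ha_def
  have ha (m : ℕ) : 0 ≤ a m := mul_nonneg (Nat.cast_nonneg _) (hpnn _)
  have hsum : Summable a := (summable_nat_add_iff 1).2 hmom
  have hμa : ∑' k : ℕ, (k : ℝ) * p k = ∑' m, a m := tsum_shift _ (by simp)
  have hp' : ∑' m, p (m + 1) = 1 := by rw [← tsum_shift p hp0, hpsum]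
  have hps' : Summable fun m => p (m + 1) := (summable_nat_add_iff 1).2 hps
  obtain ⟨n, hn⟩ : ∃ n, 0 < a (n + 2) := by
    by_contra! h
    have hle : ∑' m, a m ≤ ∑' m, 2 * p (m + 1) := by
      refine hsum.tsum_le_tsum (fun m => ?_) (hps'.mul_left 2)
      rcases m with _ | _ | m
      · simp only [ha_def]; norm_num; linarith
      · simp only [ha_def]; norm_num
      · exact (h m).trans (mul_nonneg zero_le_two (hpnn _))
    rw [tsum_mul_left, hp'] at hle
    linarith
  set F : ℝ → ℝ := fun x => ∑' m, a m * endsRatio m x with hF_def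
  have hF0 : ∑' m, a m < F 0 := by
    simp only [hF_def]
    rw [tsum_mul_endsRatio_at_zero hsum]
    simpa [ha_def] using hp1
  have hF1 : F 1 < ∑' m, a m := by
    have : F 1 = 2 := by
      have e (m : ℕ) : a m * endsRatio m 1 = 2 * p (m + 1) := by
        simp only [ha_def, endsRatio_at_one]
        push_cast
        field_simp
      simp only [hF_def, e, tsum_mul_left, hp', mul_one]
    linarith
  have hiff {x : ℝ} (hx : x ∈ Set.Ioo (0 : ℝ) 1) :
      ∑' k : ℕ, (k : ℝ) * p k = (1 - x ^ 2) * ∑' k : ℕ, (k : ℝ) * p k / (1 - x ^ k)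
        ↔ F x = ∑' m, a m := by
    rw [hμa, tsum_shift (fun k : ℕ => (k : ℝ) * p k / (1 - x ^ k)) (by simp),
      one_sub_sq_mul_tsum ha hsum hx, left_eq_add, mul_eq_zero, sub_eq_zero,
      or_iff_right hx.1.ne']
  obtain ⟨β, hβ, hFβ⟩ :=
    intermediate_value_Ioo' zero_le_one (continuousOn_tsum_mul_endsRatio ha hsum) ⟨hF1, hF0⟩
  refine ⟨β, ⟨hβ, (hiff hβ).2 hFβ⟩, fun γ hγ => ?_⟩
  exact (strictAntiOn_tsum_mul_endsRatio ha hsum hn).injOn (Set.Ioo_subset_Icc_self hγ.1)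
    (Set.Ioo_subset_Icc_self hβ) (((hiff hγ.1).1 hγ.2).trans hFβ.symm)
end

section
/- For every integer k ≥ 2, the function β ↦ (β − β^k)/(1 − β^{k+1}) is strictly increasing on the interval (0,1). Equivalently, for every integer k ≥ 2 and every β ∈ (0,1), one has 1 − k·β^{k−1} + k·β^{k+1} − β^{2k} > 0, which in turn is equivalent to the inequality Σ_{i=0}^{2k−1} β^i > (1+β)·k·β^{k−1}. -/
/-- The numerator of the derivative of `β ↦ (β - β ^ (m + 2)) / (1 - β ^ (m + 3))` is positive
on `(0, 1)`. -/
theorem one_sub_mul_pow_add_mul_pow_sub_pow_pos (m : ℕ) {b : ℝ} (h0 : 0 < b) (h1 : b < 1) :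
    0 < 1 - ((m + 2 : ℕ) : ℝ) * b ^ (m + 1) + ((m + 2 : ℕ) : ℝ) * b ^ (m + 3)
      - b ^ (2 * (m + 2)) := by
  induction m with
  | zero =>
    have h : 0 < (1 - b) ^ 3 * (1 + b) := mul_pos (pow_pos (sub_pos.2 h1) 3) (by linarith)
    norm_num
    linarith
  | succ m ih =>
    have h2 : 0 < 1 - b ^ (m + 2) := sub_pos.2 (pow_lt_one₀ h0.le h1 (by omega))
    have h3 : 0 < 1 - b ^ (m + 3) := sub_pos.2 (pow_lt_one₀ h0.le h1 (by omega))
    have h := add_pos (mul_pos h0 ih) (mul_pos (mul_pos (sub_pos.2 h1) h2) h3)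
    refine h.trans_eq ?_
    push_cast
    ring

/-- for every `k ≥ 2` the map `β ↦ (β − β^k)/(1 − β^{k+1})` is strictly
increasing on `(0,1)`; equivalently `1 − k·β^{k−1} + k·β^{k+1} − β^{2k} > 0` on `(0,1)`,
which is in turn equivalent to `Σ_{i=0}^{2k−1} β^i > (1+β)·k·β^{k−1}`. -/
theorem auxiliary_function_strictly_increasing :
    ∀ k : ℕ, 2 ≤ k →
      StrictMonoOn (fun β : ℝ => (β - β ^ k) / (1 - β ^ (k + 1))) (Set.Ioo 0 1)
      ∧ (∀ β : ℝ, β ∈ Set.Ioo (0 : ℝ) 1 →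
          0 < 1 - (k : ℝ) * β ^ (k - 1) + (k : ℝ) * β ^ (k + 1) - β ^ (2 * k))
      ∧ (∀ β : ℝ, β ∈ Set.Ioo (0 : ℝ) 1 →
          (1 + β) * (k : ℝ) * β ^ (k - 1) < ∑ i ∈ Finset.range (2 * k), β ^ i) := by
  intro k hk
  obtain ⟨m, rfl⟩ := Nat.exists_eq_add_of_le' hk
  have key : ∀ β : ℝ, β ∈ Set.Ioo (0 : ℝ) 1 →
      0 < 1 - ((m + 2 : ℕ) : ℝ) * β ^ (m + 2 - 1) + ((m + 2 : ℕ) : ℝ) * β ^ (m + 2 + 1)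
        - β ^ (2 * (m + 2)) := fun β hβ =>
    one_sub_mul_pow_add_mul_pow_sub_pow_pos m hβ.1 hβ.2
  refine ⟨?_, key, fun β hβ => ?_⟩
  · have hden : ∀ β ∈ Set.Ioo (0 : ℝ) 1, 0 < 1 - β ^ (m + 2 + 1) := fun β hβ =>
      sub_pos.2 (pow_lt_one₀ hβ.1.le hβ.2 (by omega))
    have hderiv : ∀ β ∈ Set.Ioo (0 : ℝ) 1, HasDerivAt
        (fun β : ℝ => (β - β ^ (m + 2)) / (1 - β ^ (m + 2 + 1)))
        ((1 - ((m + 2 : ℕ) : ℝ) * β ^ (m + 2 - 1) + ((m + 2 : ℕ) : ℝ) * β ^ (m + 2 + 1)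
          - β ^ (2 * (m + 2))) / (1 - β ^ (m + 2 + 1)) ^ 2) β := fun β hβ => by
      refine (((hasDerivAt_id' β).fun_sub (hasDerivAt_pow (m + 2) β)).fun_div
        ((hasDerivAt_pow (m + 2 + 1) β).const_sub 1) (hden β hβ).ne').congr_deriv ?_
      congr 1
      simp only [Nat.add_succ_sub_one]
      push_cast
      ring
    refine strictMonoOn_of_deriv_pos (convex_Ioo 0 1)
      (fun β hβ => (hderiv β hβ).continuousAt.continuousWithinAt) fun β hβ => ?_
    rw [interior_Ioo] at hβ
    rw [(hderiv β hβ).deriv]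
    exact div_pos (key β hβ) (pow_pos (hden β hβ) 2)
  · refine lt_of_mul_lt_mul_left ?_ (sub_pos.2 hβ.2).le
    rw [mul_neg_geom_sum]
    have h := key β hβ
    simp only [Nat.add_succ_sub_one, pow_succ β (m + 2), pow_succ β (m + 1)] at h ⊢
    linarith
end

section
/- Let p = (p_k)_{k≥1} be a probability distribution on the positive integers with p_1 > 0 and 2 < μ_p := Σ_{k≥1} k·p_k < ∞, and let β(p) ∈ (0,1) be the unique solution of Σ_{k≥1} k·p_k = (1−β²)·Σ_{k≥1} k·p_k/(1−β^k). Then p_1/(2·μ_p) < β(p) ≤ 1 − (μ_p − 2)/(2·μ_p). In particular, for every η ∈ (0, 1/2), if μ_p ≥ 2/(1−2η) then β(p) ≤ 1 − η. -/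
/-- The last of the powers `β, …, β ^ k` is at most their average. -/
theorem nat_mul_pow_mul_one_sub_le {β : ℝ} (h0 : 0 ≤ β) (h1 : β ≤ 1) (k : ℕ) :
    (k : ℝ) * β ^ k * (1 - β) ≤ β * (1 - β ^ k) := by
  induction k with
  | zero => simp
  | succ k ih =>
    have hk : 0 ≤ 1 - β ^ k := sub_nonneg.2 (pow_le_one₀ h0 h1)
    have h : 0 ≤ β * (1 - β) * (1 - β ^ k) :=
      mul_nonneg (mul_nonneg h0 (sub_nonneg.2 h1)) hk
    have h' := mul_le_mul_of_nonneg_left ih h0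
    push_cast
    rw [pow_succ]
    linarith

/-- bounds on `β(p)`: the solution `β ∈ (0,1)` of the fixed-point
equation satisfies `p₁/(2μ_p) < β ≤ 1 − (μ_p − 2)/(2μ_p)`; in particular, if
`μ_p ≥ 2/(1−2η)` for some `η ∈ (0,1/2)`, then `β ≤ 1 − η`. -/
theorem beta_bounds
    (p : ℕ → ℝ) (hp0 : p 0 = 0) (hpnn : ∀ i, 0 ≤ p i) (hpsum : ∑' i : ℕ, p i = 1)
    (hp1 : 0 < p 1) (hmom : Summable fun k : ℕ => (k : ℝ) * p k)
    (hμ : 2 < ∑' k : ℕ, (k : ℝ) * p k)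
    (β : ℝ) (hβ : β ∈ Set.Ioo (0 : ℝ) 1)
    (hfix : ∑' k : ℕ, (k : ℝ) * p k
      = (1 - β ^ 2) * ∑' k : ℕ, (k : ℝ) * p k / (1 - β ^ k)) :
    p 1 / (2 * ∑' k : ℕ, (k : ℝ) * p k) < β
    ∧ β ≤ 1 - ((∑' k : ℕ, (k : ℝ) * p k) - 2) / (2 * ∑' k : ℕ, (k : ℝ) * p k)
    ∧ ∀ η : ℝ, 0 < η → η < 1 / 2 →
        2 / (1 - 2 * η) ≤ ∑' k : ℕ, (k : ℝ) * p k → β ≤ 1 - η := by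
  obtain ⟨hb0, hb1⟩ := hβ
  have hc : 0 < 1 - β := sub_pos.2 hb1
  have hps : Summable p := by
    by_contra h
    rw [tsum_eq_zero_of_not_summable h] at hpsum
    exact zero_ne_one hpsum
  have hden : ∀ k : ℕ, k ≠ 0 → 1 - β ≤ 1 - β ^ k := fun k hk =>
    sub_le_sub_left (pow_le_of_le_one hb0.le hb1.le hk) 1
  have hupper : ∀ k : ℕ,
      (k : ℝ) * p k / (1 - β ^ k) ≤ k * p k + β / (1 - β) * p k := by
    intro k
    rcases eq_or_ne k 0 with rfl | hk
    · simp [hp0]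
    · have hd : 0 < 1 - β ^ k := hc.trans_le (hden k hk)
      have key := mul_le_mul_of_nonneg_right
        (nat_mul_pow_mul_one_sub_le hb0.le hb1.le k) (hpnn k)
      have e : (k : ℝ) * p k + β / (1 - β) * p k
          = (k * p k * (1 - β) + β * p k) / (1 - β) := by
        field_simp
      rw [e, div_le_div_iff₀ hd hc]
      linarith
  have hlower : ∀ k : ℕ,
      (k : ℝ) * p k + (if k = 1 then p 1 * (β / (1 - β)) else 0)
        ≤ k * p k / (1 - β ^ k) := by
    intro k
    rcases eq_or_ne k 0 with rfl | hk
    · simp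
    · have hd : 0 < 1 - β ^ k := hc.trans_le (hden k hk)
      split_ifs with h
      · subst h
        apply le_of_eq
        simp only [pow_one, Nat.cast_one]
        field_simp
        ring
      · rw [add_zero]
        exact le_div_self (mul_nonneg k.cast_nonneg (hpnn k)) hd
          (sub_le_self 1 (pow_nonneg hb0.le k))
  have hsU : Summable fun k : ℕ => (k : ℝ) * p k + β / (1 - β) * p k :=
    hmom.add (hps.mul_left _)
  have hsL := hasSum_ite_eq (1 : ℕ) (p 1 * (β / (1 - β)))
  have hsg : Summable fun k : ℕ => (k : ℝ) * p k / (1 - β ^ k) :=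
    hsU.of_nonneg_of_le (fun k => div_nonneg (mul_nonneg k.cast_nonneg (hpnn k))
      (sub_nonneg.2 (pow_le_one₀ hb0.le hb1.le))) hupper
  have hU := hsg.tsum_le_tsum hupper hsU
  rw [hmom.tsum_add (hps.mul_left _), tsum_mul_left, hpsum, mul_one] at hU
  have hL := (hmom.add hsL.summable).tsum_le_tsum hlower hsg
  rw [hmom.tsum_add hsL.summable, hsL.tsum_eq] at hL
  generalize (∑' k : ℕ, (k : ℝ) * p k / (1 - β ^ k)) = G at *
  generalize (∑' k : ℕ, (k : ℝ) * p k) = m at *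
  have hsq : 0 < 1 - β ^ 2 := by nlinarith
  have hU' : m * β ≤ 1 + β := by
    have h := mul_le_mul_of_nonneg_left hU hsq.le
    have e : (1 - β ^ 2) * (m + β / (1 - β)) = (1 - β ^ 2) * m + (1 + β) * β := by
      field_simp
      ring
    rw [← hfix, e] at h
    exact le_of_mul_le_mul_right (by linarith) hb0
  have hL' : p 1 * (1 + β) ≤ m * β := by
    have h := mul_le_mul_of_nonneg_left hL hsq.le
    have e : (1 - β ^ 2) * (m + p 1 * (β / (1 - β)))
        = (1 - β ^ 2) * m + p 1 * (1 + β) * β := by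
      field_simp
      ring
    rw [← hfix, e] at h
    exact le_of_mul_le_mul_right (by linarith) hb0
  have hm : 0 < m := by linarith
  have hbound : β ≤ 1 - (m - 2) / (2 * m) := by
    have e : 1 - (m - 2) / (2 * m) = (m + 2) / (2 * m) := by
      field_simp
      ring
    rw [e, le_div_iff₀ (by positivity)]
    nlinarith
  refine ⟨?_, hbound, fun η _ hη hηm => hbound.trans ?_⟩
  · rw [div_lt_iff₀ (by positivity)]
    nlinarith [mul_pos hp1 hb0, mul_pos hm hb0]
  · rw [div_le_iff₀ (by linarith)] at hηm
    have : η ≤ (m - 2) / (2 * m) := by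
      rw [le_div_iff₀ (by positivity)]
      linarith
    linarith
end

section
/- For every η ∈ (0, 1/2) there exists a constant C(η) < ∞ such that for all probability distributions p = (p_k)_{k≥1} and q = (q_k)_{k≥1} on the positive integers with p_1 > 0, q_1 > 0, Σ_k k·p_k ≥ 2/(1−2η) and Σ_k k·q_k ≥ 2/(1−2η) (both finite), the unique solutions β(p), β(q) ∈ (0,1) of the respective equations Σ_k k·p_k = (1−β²)·Σ_k k·p_k/(1−β^k) and Σ_k k·q_k = (1−β²)·Σ_k k·q_k/(1−β^k) satisfy |β(p) − β(q)| ≤ C(η)·Σ_{k≥1} k·|p_k − q_k|. -/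
/-- The weight `(b - b ^ (k - 1)) / (1 - b ^ k)`, equal to
`(1 - (1 - b ^ 2) / (1 - b ^ k)) / b` for `k ≥ 1`. -/
noncomputable def betaWeight (b : ℝ) (k : ℕ) : ℝ := (b - b ^ (k - 1)) / (1 - b ^ k)

open Finset in
theorem one_sub_mul_one_sub_le_sum {a b : ℝ} (ha : 0 < a) (ha1 : a < 1) (hb : 0 < b) (hb1 : b < 1)
    {n : ℕ} (hn : 1 ≤ n) :
    (1 - a) * (1 - b) ≤
      ∑ i ∈ range (n + 1), (a * b) ^ i - ∑ i ∈ range (n + 1), b ^ i * a ^ (n - i) := by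
  have hpair : ∑ i ∈ range (n + 1), (a ^ i - a ^ (n - i)) * (b ^ i - b ^ (n - i)) =
      2 * (∑ i ∈ range (n + 1), (a * b) ^ i - ∑ i ∈ range (n + 1), b ^ i * a ^ (n - i)) := by
    have h1 := sum_range_reflect (fun i => (a * b) ^ i) (n + 1)
    have h2 := sum_range_reflect (fun i => b ^ i * a ^ (n - i)) (n + 1)
    have h2' : ∑ i ∈ range (n + 1), b ^ (n - i) * a ^ i =
        ∑ i ∈ range (n + 1), b ^ i * a ^ (n - i) := by
      rw [← h2]
      refine sum_congr rfl fun i hi => ?_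
      have hi' : i ≤ n := Nat.lt_succ_iff.mp (mem_range.mp hi)
      simp [Nat.sub_sub_self hi']
    have h1' : ∑ i ∈ range (n + 1), (a * b) ^ (n - i) = ∑ i ∈ range (n + 1), (a * b) ^ i := by
      rw [← h1]
      simp
    calc _ = ∑ i ∈ range (n + 1), ((a * b) ^ i + (a * b) ^ (n - i) - b ^ i * a ^ (n - i)
            - b ^ (n - i) * a ^ i) := by
          refine sum_congr rfl fun i _ => ?_
          rw [mul_pow, mul_pow]
          ring
      _ = _ := by
          rw [sum_sub_distrib, sum_sub_distrib, sum_add_distrib, h1', h2']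
          ring
  have hnonneg : ∀ i ∈ range (n + 1), 0 ≤ (a ^ i - a ^ (n - i)) * (b ^ i - b ^ (n - i)) := by
    intro i _
    rcases le_total i (n - i) with h | h
    · exact mul_nonneg (sub_nonneg.2 (pow_le_pow_of_le_one ha.le ha1.le h))
        (sub_nonneg.2 (pow_le_pow_of_le_one hb.le hb1.le h))
    · exact mul_nonneg_of_nonpos_of_nonpos (sub_nonpos.2 (pow_le_pow_of_le_one ha.le ha1.le h))
        (sub_nonpos.2 (pow_le_pow_of_le_one hb.le hb1.le h))
  have hends : 2 * ((1 - a ^ n) * (1 - b ^ n)) ≤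
      ∑ i ∈ range (n + 1), (a ^ i - a ^ (n - i)) * (b ^ i - b ^ (n - i)) := by
    have hsub : ({0, n} : Finset ℕ) ⊆ range (n + 1) := by
      intro i hi
      simp only [mem_insert, mem_singleton] at hi
      rw [mem_range]
      omega
    refine le_trans (le_of_eq ?_) (sum_le_sum_of_subset_of_nonneg hsub fun i hi _ => hnonneg i hi)
    rw [sum_pair (by omega)]
    simp
    ring
  have han : a ^ n ≤ a := pow_le_of_le_one ha.le ha1.le (by omega)
  have hbn : b ^ n ≤ b := pow_le_of_le_one hb.le hb1.le (by omega)
  have := mul_le_mul (sub_le_sub_left han 1) (sub_le_sub_left hbn 1) (by linarith) (by linarith)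
  linarith

theorem betaWeight_sub_ge {a b : ℝ} (ha : 0 < a) (hb1 : b < 1) (hab : a ≤ b)
    {k : ℕ} (hk : 3 ≤ k) :
    (b - a) * (1 - b) ^ 3 ≤ betaWeight b k - betaWeight a k := by
  have hb := ha.trans_le hab
  have ha1 := hab.trans_lt hb1
  obtain ⟨n, rfl⟩ : ∃ n, k = n + 2 := ⟨k - 2, by omega⟩
  have hsum := one_sub_mul_one_sub_le_sum ha ha1 hb hb1 (n := n) (by omega)
  have hg1 := geom_sum_mul (a * b) (n + 1)
  have hg2 := (Commute.all b a).geom_sum₂_mul (n + 1)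
  simp only [Nat.add_sub_cancel] at hg2
  have hak : 0 < 1 - a ^ (n + 2) := sub_pos.2 (pow_lt_one₀ ha.le ha1 (by omega))
  have hbk : 0 < 1 - b ^ (n + 2) := sub_pos.2 (pow_lt_one₀ hb.le hb1 (by omega))
  have hak' : 0 < a ^ (n + 2) := by positivity
  have hbk' : 0 < b ^ (n + 2) := by positivity
  have hab1 : a * b ≤ b := by nlinarith
  have hnum : (b - a) * (1 - b) ^ 3 ≤ (b - b ^ (n + 1)) * (1 - a ^ (n + 2)) -
      (1 - b ^ (n + 2)) * (a - a ^ (n + 1)) := by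
    have hid : (b - b ^ (n + 1)) * (1 - a ^ (n + 2)) - (1 - b ^ (n + 2)) * (a - a ^ (n + 1)) =
        (b - a) * (1 - a * b) * (∑ i ∈ Finset.range (n + 1), (a * b) ^ i -
          ∑ i ∈ Finset.range (n + 1), b ^ i * a ^ (n - i)) := by
      have : (a * b) ^ (n + 1) = a ^ (n + 1) * b ^ (n + 1) := mul_pow _ _ _
      rw [this] at hg1
      linear_combination (b - a) * hg1 + (1 - a * b) * hg2
    rw [hid]
    have h1 : (1 - b) ^ 2 ≤ (1 - a) * (1 - b) := by nlinarith
    have h2 : (1 - b) * (1 - b) ^ 2 ≤ (1 - a * b) * _ :=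
      mul_le_mul (by linarith) (h1.trans hsum) (by positivity) (by linarith)
    have h3 := mul_le_mul_of_nonneg_left h2 (sub_nonneg.2 hab)
    linarith
  rw [betaWeight, betaWeight, div_sub_div _ _ hbk.ne' hak.ne', le_div_iff₀ (by positivity)]
  refine le_trans ?_ hnum
  have h0 : 0 ≤ (b - a) * (1 - b) ^ 3 :=
    mul_nonneg (sub_nonneg.2 hab) (pow_nonneg (by linarith) 3)
  exact mul_le_of_le_one_right h0 (mul_le_one₀ (by linarith) hak.le (by linarith))

theorem abs_betaWeight_le_one {b : ℝ} (hb : 0 < b) (hb1 : b < 1) {k : ℕ} (hk : 1 ≤ k) :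
    |betaWeight b k| ≤ 1 := by
  obtain ⟨n, rfl⟩ : ∃ n, k = n + 1 := ⟨k - 1, by omega⟩
  have hbk : 0 < 1 - b ^ (n + 1) := sub_pos.2 (pow_lt_one₀ hb.le hb1 (by omega))
  have hn0 : 0 < b ^ n := by positivity
  have hn1 : b ^ n ≤ 1 := pow_le_one₀ hb.le hb1.le
  rw [betaWeight, abs_div, abs_of_pos hbk, div_le_one hbk, Nat.add_sub_cancel, abs_le, pow_succ]
  constructor <;> nlinarith

/-- The defining equation of `β` forces `Σ k p_k * betaWeight β k = 0`. -/
theorem hasSum_mul_betaWeight {p : ℕ → ℝ} {b : ℝ} (hp : ∀ i, 0 ≤ p i)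
    (hs : Summable fun k : ℕ => (k : ℝ) * p k) (hb : b ∈ Set.Ioo (0 : ℝ) 1)
    (he : ∑' k : ℕ, (k : ℝ) * p k = (1 - b ^ 2) * ∑' k : ℕ, (k : ℝ) * p k / (1 - b ^ k)) :
    HasSum (fun k : ℕ => (k : ℝ) * p k / (1 - b ^ k))
        (∑' k : ℕ, (k : ℝ) * p k / (1 - b ^ k)) ∧
      HasSum (fun k : ℕ => (k : ℝ) * p k * betaWeight b k) 0 := by
  obtain ⟨hb0, hb1⟩ := hb
  have hs' : Summable fun k : ℕ => (k : ℝ) * p k / (1 - b ^ k) := by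
    refine Summable.of_nonneg_of_le (fun k => ?_) (fun k => ?_) (hs.div_const (1 - b))
    · exact div_nonneg (mul_nonneg k.cast_nonneg (hp k))
        (sub_nonneg.2 (pow_le_one₀ hb0.le hb1.le))
    · rcases Nat.eq_zero_or_pos k with rfl | hk
      · simp
      · exact div_le_div_of_nonneg_left (mul_nonneg k.cast_nonneg (hp k)) (sub_pos.2 hb1)
          (sub_le_sub_left (pow_le_of_le_one hb0.le hb1.le hk.ne') 1)
  refine ⟨hs'.hasSum, ?_⟩
  have h := (hs.hasSum.sub (hs'.hasSum.mul_left (1 - b ^ 2))).div_const b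
  rw [← he, sub_self, zero_div] at h
  refine h.congr_fun ?_
  intro k
  rcases Nat.eq_zero_or_pos k with rfl | hk
  · simp
  · obtain ⟨n, rfl⟩ : ∃ n, k = n + 1 := ⟨k - 1, by omega⟩
    have hbk : 1 - b ^ (n + 1) ≠ 0 := (sub_pos.2 (pow_lt_one₀ hb0.le hb1 (by omega))).ne'
    rw [betaWeight, Nat.add_sub_cancel]
    field_simp
    ring

theorem mul_one_sub_sq_div_le {b : ℝ} (hb : 0 < b) (hb1 : b < 1) (k : ℕ) :
    (1 - b ^ 2) * (k / (1 - b ^ k)) ≤ 2 + (1 - b ^ 2) * k := by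
  rcases Nat.eq_zero_or_pos k with rfl | hk
  · simp
  have hbk : 0 < 1 - b ^ k := sub_pos.2 (pow_lt_one₀ hb.le hb1 (by omega))
  have hgeom := geom_sum_mul_neg b k
  have hle : (k : ℝ) * b ^ k ≤ ∑ i ∈ Finset.range k, b ^ i := by
    have := Finset.card_nsmul_le_sum (Finset.range k) (fun i => b ^ i) (b ^ k)
      fun i hi => pow_le_pow_of_le_one hb.le hb1.le (Finset.mem_range.1 hi).le
    simpa using this
  have h1 : (k : ℝ) * b ^ k * (1 - b) ≤ 1 - b ^ k := by
    rw [← hgeom]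
    exact mul_le_mul_of_nonneg_right hle (by linarith)
  rw [← mul_div_assoc, div_le_iff₀ hbk]
  have h2 := mul_le_mul_of_nonneg_left h1 (show 0 ≤ 1 + b by linarith)
  nlinarith

theorem sq_mul_mean_le_two {p : ℕ → ℝ} {b : ℝ} (hp : ∀ i, 0 ≤ p i) (h1 : HasSum p 1)
    (hs : Summable fun k : ℕ => (k : ℝ) * p k) (hb : b ∈ Set.Ioo (0 : ℝ) 1)
    (he : ∑' k : ℕ, (k : ℝ) * p k = (1 - b ^ 2) * ∑' k : ℕ, (k : ℝ) * p k / (1 - b ^ k)) :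
    b ^ 2 * ∑' k : ℕ, (k : ℝ) * p k ≤ 2 := by
  have hl := (hasSum_mul_betaWeight hp hs hb he).1.mul_left (1 - b ^ 2)
  have hr := (h1.mul_left 2).add (hs.hasSum.mul_left (1 - b ^ 2))
  have := hasSum_le (fun k => ?_) hl hr
  · linarith
  · have := mul_le_mul_of_nonneg_right (mul_one_sub_sq_div_le hb.1 hb.2 k) (hp k)
    calc _ = (1 - b ^ 2) * (k / (1 - b ^ k)) * p k := by ring
      _ ≤ _ := this
      _ = _ := by ring

theorem beta_le_one_sub {p : ℕ → ℝ} {b η : ℝ} (hη : 0 < η) (hη2 : η < 1 / 2)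
    (hp : ∀ i, 0 ≤ p i) (h1 : HasSum p 1) (hs : Summable fun k : ℕ => (k : ℝ) * p k)
    (hm : 2 / (1 - 2 * η) ≤ ∑' k : ℕ, (k : ℝ) * p k) (hb : b ∈ Set.Ioo (0 : ℝ) 1)
    (he : ∑' k : ℕ, (k : ℝ) * p k = (1 - b ^ 2) * ∑' k : ℕ, (k : ℝ) * p k / (1 - b ^ k)) :
    b ≤ 1 - η := by
  have h := (mul_le_mul_of_nonneg_left hm (sq_nonneg b)).trans
    (sq_mul_mean_le_two hp h1 hs hb he)
  rw [← mul_div_assoc, div_le_iff₀ (by linarith)] at h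
  nlinarith [sq_nonneg η]

theorem beta_sub_mul_le {p q : ℕ → ℝ} {a b η : ℝ} (hη : 0 < η) (hbη : b ≤ 1 - η)
    (ha : 0 < a) (hab : a ≤ b) (hp0 : p 0 = 0) (hp : ∀ i, 0 ≤ p i) (h1 : HasSum p 1)
    (hps : Summable fun k : ℕ => (k : ℝ) * p k) (hqs : Summable fun k : ℕ => (k : ℝ) * q k)
    (hpa : HasSum (fun k : ℕ => (k : ℝ) * p k * betaWeight a k) 0)
    (hqb : HasSum (fun k : ℕ => (k : ℝ) * q k * betaWeight b k) 0) :
    (b - a) * η ^ 3 * (∑' k : ℕ, (k : ℝ) * p k - 2) ≤ ∑' k : ℕ, (k : ℝ) * |p k - q k| := by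
  have hb := ha.trans_le hab
  have hb1 : b < 1 := by linarith
  have hd : Summable fun k : ℕ => (k : ℝ) * |p k - q k| := by
    refine (hps.sub hqs).abs.congr fun k => ?_
    rw [← mul_sub, abs_mul, Nat.abs_cast]
  have hbound : ∀ k : ℕ, ‖(k : ℝ) * (p k - q k) * betaWeight b k‖ ≤ (k : ℝ) * |p k - q k| := by
    intro k
    rcases Nat.eq_zero_or_pos k with rfl | hk
    · simp
    · rw [Real.norm_eq_abs, abs_mul, abs_mul, Nat.abs_cast]
      exact mul_le_of_le_one_right (by positivity) (abs_betaWeight_le_one hb hb1 hk)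
  have hdiff := (Summable.of_norm_bounded hd hbound).hasSum
  have hup := hasSum_le (fun k => (le_abs_self _).trans (hbound k)) hdiff hd.hasSum
  have hmid := (hdiff.add hqb).sub hpa
  have hlow := (hps.hasSum.sub (h1.mul_left 2)).mul_left ((b - a) * η ^ 3)
  have := hasSum_le (fun k => ?_) hlow hmid
  · linarith
  · have hc : 0 ≤ (b - a) * η ^ 3 := mul_nonneg (sub_nonneg.2 hab) (by positivity)
    have hrw : (k : ℝ) * (p k - q k) * betaWeight b k + k * q k * betaWeight b k
        - k * p k * betaWeight a k = k * p k * (betaWeight b k - betaWeight a k) := by ring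
    rw [hrw]
    rcases (by omega : k = 0 ∨ k = 1 ∨ k = 2 ∨ 3 ≤ k) with rfl | rfl | rfl | hk
    · simp [hp0]
    · have hw : ∀ x : ℝ, x < 1 → betaWeight x 1 = -1 := fun x hx => by
        have : 1 - x ≠ 0 := by linarith
        rw [betaWeight]
        field_simp
        ring
      rw [hw b hb1, hw a (by linarith)]
      have := mul_nonneg hc (hp 1)
      push_cast
      linarith
    · simp [betaWeight]
    · have hw : (b - a) * η ^ 3 ≤ betaWeight b k - betaWeight a k :=
        (mul_le_mul_of_nonneg_left (pow_le_pow_left₀ hη.le (by linarith) 3)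
          (sub_nonneg.2 hab)).trans (betaWeight_sub_ge ha hb1 hab hk)
      have hkp : 0 ≤ (k : ℝ) * p k := mul_nonneg k.cast_nonneg (hp k)
      have h2 := mul_le_mul_of_nonneg_left hw hkp
      have h3 := mul_nonneg hc (hp k)
      linarith


/-- the map `p ↦ β(p)` is uniformly Lipschitz with respect to the metric
`d(p,q) = Σ_k k·|p_k − q_k|` on the set of probability distributions on the positive
integers with first moment at least `2/(1−2η)`. -/
theorem beta_uniformly_Lipschitz :
    ∀ η : ℝ, 0 < η → η < 1 / 2 → ∃ C : ℝ, ∀ p q : ℕ → ℝ, ∀ βp βq : ℝ,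
      p 0 = 0 → (∀ i, 0 ≤ p i) → (∑' i : ℕ, p i = 1) → 0 < p 1 →
      (Summable fun k : ℕ => (k : ℝ) * p k) →
      2 / (1 - 2 * η) ≤ ∑' k : ℕ, (k : ℝ) * p k →
      q 0 = 0 → (∀ i, 0 ≤ q i) → (∑' i : ℕ, q i = 1) → 0 < q 1 →
      (Summable fun k : ℕ => (k : ℝ) * q k) →
      2 / (1 - 2 * η) ≤ ∑' k : ℕ, (k : ℝ) * q k →
      βp ∈ Set.Ioo (0 : ℝ) 1 →
      (∑' k : ℕ, (k : ℝ) * p k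
        = (1 - βp ^ 2) * ∑' k : ℕ, (k : ℝ) * p k / (1 - βp ^ k)) →
      βq ∈ Set.Ioo (0 : ℝ) 1 →
      (∑' k : ℕ, (k : ℝ) * q k
        = (1 - βq ^ 2) * ∑' k : ℕ, (k : ℝ) * q k / (1 - βq ^ k)) →
      |βp - βq| ≤ C * ∑' k : ℕ, (k : ℝ) * |p k - q k| := by
  intro η hη hη2
  have hden : 0 < 1 - 2 * η := by linarith
  have hδ : 2 / (1 - 2 * η) - 2 = 4 * η / (1 - 2 * η) := by
    field_simp
    ring
  have hδ0 : 0 < 2 / (1 - 2 * η) - 2 := by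
    rw [hδ]
    positivity
  refine ⟨(η ^ 3 * (2 / (1 - 2 * η) - 2))⁻¹, ?_⟩
  intro p q βp βq hp0 hp hp1 _ hps hpm hq0 hq hq1 _ hqs hqm hβp hep hβq heq
  have hasSum_one : ∀ r : ℕ → ℝ, ∑' i, r i = 1 → HasSum r 1 := fun r hr => by
    have hsum : Summable r := by
      by_contra h
      rw [tsum_eq_zero_of_not_summable h] at hr
      exact zero_ne_one hr
    exact hr ▸ hsum.hasSum
  have hP := hasSum_one p hp1
  have hQ := hasSum_one q hq1
  have hwp := (hasSum_mul_betaWeight hp hps hβp hep).2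
  have hwq := (hasSum_mul_betaWeight hq hqs hβq heq).2
  rw [inv_mul_eq_div, le_div_iff₀ (by positivity), ← mul_assoc]
  rcases le_total βp βq with h | h
  · have key := beta_sub_mul_le hη (beta_le_one_sub hη hη2 hq hQ hqs hqm hβq heq) hβp.1 h
      hp0 hp hP hps hqs hwp hwq
    rw [abs_sub_comm, abs_of_nonneg (sub_nonneg.2 h)]
    refine le_trans (mul_le_mul_of_nonneg_left (by linarith) ?_) key
    exact mul_nonneg (sub_nonneg.2 h) (by positivity)
  · have key := beta_sub_mul_le hη (beta_le_one_sub hη hη2 hp hP hps hpm hβp hep) hβq.1 h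
      hq0 hq hQ hqs hps hwq hwp
    simp only [abs_sub_comm (q _)] at key
    rw [abs_of_nonneg (sub_nonneg.2 h)]
    refine le_trans (mul_le_mul_of_nonneg_left (by linarith) ?_) key
    exact mul_nonneg (sub_nonneg.2 h) (by positivity)
end
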